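/- If β ≠ 0, then for every open neighborhood U of Γ̂ in ℝ⁵ and every integer q with 1 ≤ q ≤ 5, the system ẋ₁ = x₂, ẋ₂ = x₁ − x₁³ − εδx₂ + βu₁, ε̇ = 0, u̇₁ = −ωu₂, u̇₂ = ωu₁ is not (q, 5−q)-integrable in the Bogoyavlenskij sense with real-analytic data on U. (This is the real-analytic consequence of the paper's Proposition 5.1, which asserts real-meromorphic nonintegrability.) -/

import Mathlib

open MeasureTheory Filter Topology

/-- Bogoyavlenskij `(q, m)`-integrability with real-analytic data on an open set `U`:
there are `q` real-analytic vector fields `f₁ = f, …, f_q` on `U`, linearly independent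
at almost every point of `U` and pairwise commuting, and `m` real-analytic functions
`F₁, …, F_m` on `U` whose derivatives are linearly independent at almost every point of
`U` and which are first integrals of every `f_j`. -/
def BogoyavlenskijIntegrable {E : Type*} [NormedAddCommGroup E] [NormedSpace ℝ E]
    [MeasureSpace E] (f : E → E) (U : Set E) (q m : ℕ) : Prop :=
  ∃ (fs : Fin q → E → E) (Fs : Fin m → E → ℝ),
    (∀ (h : 0 < q) (x : E), x ∈ U → fs ⟨0, h⟩ x = f x) ∧
    (∀ j, AnalyticOnNhd ℝ (fs j) U) ∧
    (∀ k, AnalyticOnNhd ℝ (Fs k) U) ∧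
    (∀ j k, ∀ x ∈ U, fderiv ℝ (fs k) x (fs j x) - fderiv ℝ (fs j) x (fs k x) = 0) ∧
    (∀ᵐ x ∂(volume.restrict U), LinearIndependent ℝ (fun j => fs j x)) ∧
    (∀ᵐ x ∂(volume.restrict U), LinearIndependent ℝ (fun k => fderiv ℝ (Fs k) x)) ∧
    (∀ k j, ∀ x ∈ U, fderiv ℝ (Fs k) x (fs j x) = 0)

/-- The autonomous vector field on `ℝ⁵` (coordinates `(x₁, x₂, ε, u₁, u₂)`) of the
periodically forced Duffing oscillator `ẋ₁ = x₂, ẋ₂ = x₁ − x₁³ − εδx₂ + βu₁,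
ε̇ = 0, u̇₁ = −ωu₂, u̇₂ = ωu₁`. -/
noncomputable def duffingField (β δ ω : ℝ) (x : Fin 5 → ℝ) : Fin 5 → ℝ :=
  ![x 1, x 0 - x 0 ^ 3 - x 2 * δ * x 1 + β * x 3, 0, -(ω * x 4), ω * x 3]

/-- The homoclinic set `Γ̂ = {(x^h(t), 0, 0, 0) : t ∈ ℝ} ∪ {0}` in `ℝ⁵`, where
`x^h(t) = (√2 sech t, −√2 sech t tanh t)`. -/
noncomputable def homoclinicSet : Set (Fin 5 → ℝ) :=
  Set.range (fun t : ℝ =>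
      ![Real.sqrt 2 * (Real.cosh t)⁻¹,
        -(Real.sqrt 2 * (Real.cosh t)⁻¹ * Real.tanh t), 0, 0, 0])
    ∪ {![0, 0, 0, 0, 0]}

/-- The `i`-th partial derivative of a function on `ℝ⁵`. -/
noncomputable def partialDeriv (i : Fin 5) (φ : (Fin 5 → ℝ) → ℝ) (x : Fin 5 → ℝ) : ℝ :=
  fderiv ℝ φ x (Pi.single i 1)

/-- The `j`-th iterated derivative of `φ` at `x` in the direction `ξ`. -/
noncomputable def jet : ℕ → ((Fin 5 → ℝ) → ℝ) → (Fin 5 → ℝ) → (Fin 5 → ℝ) → ℝ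
  | 0, φ, x, _ => φ x
  | j + 1, φ, x, ξ => ∑ i, ξ i * jet j (partialDeriv i φ) x ξ

theorem fderiv_eq_sum_partialDeriv (φ : (Fin 5 → ℝ) → ℝ) (x ξ : Fin 5 → ℝ) :
    fderiv ℝ φ x ξ = ∑ i, ξ i * partialDeriv i φ x := by
  conv_lhs => rw [pi_eq_sum_univ' ξ]
  simp [map_sum, partialDeriv]

theorem jet_one (φ : (Fin 5 → ℝ) → ℝ) (x ξ : Fin 5 → ℝ) :
    jet 1 φ x ξ = fderiv ℝ φ x ξ := by
  rw [fderiv_eq_sum_partialDeriv]; rfl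

section
variable {U : Set (Fin 5 → ℝ)}

theorem AnalyticOnNhd.partialDeriv {φ : (Fin 5 → ℝ) → ℝ} (h : AnalyticOnNhd ℝ φ U) (i : Fin 5) :
    AnalyticOnNhd ℝ (partialDeriv i φ) U := by
  intro x hx
  exact ((ContinuousLinearMap.apply ℝ ℝ (Pi.single i (1 : ℝ) : Fin 5 → ℝ)).analyticAt _).comp
    (h.fderiv x hx)

theorem partialDeriv_congr (hU : IsOpen U) {φ ψ : (Fin 5 → ℝ) → ℝ} (h : Set.EqOn φ ψ U)
    (i : Fin 5) : Set.EqOn (partialDeriv i φ) (partialDeriv i ψ) U := by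
  intro x hx
  unfold partialDeriv
  rw [(h.eventuallyEq_of_mem (hU.mem_nhds hx)).fderiv_eq]

theorem partialDeriv_comm {φ : (Fin 5 → ℝ) → ℝ} (h : AnalyticOnNhd ℝ φ U) (i k : Fin 5) :
    Set.EqOn (partialDeriv i (partialDeriv k φ)) (partialDeriv k (partialDeriv i φ)) U := by
  intro x hx
  have hd : DifferentiableAt ℝ (fderiv ℝ φ) x := (h.fderiv x hx).differentiableAt
  have key : ∀ a b : Fin 5, partialDeriv a (partialDeriv b φ) x
      = fderiv ℝ (fderiv ℝ φ) x (Pi.single a 1) (Pi.single b 1) := by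
    intro a b
    change fderiv ℝ (fun y => fderiv ℝ φ y (Pi.single b 1)) x (Pi.single a 1) = _
    rw [fderiv_clm_apply hd (differentiableAt_const _)]
    simp
  rw [key, key]
  exact (h x hx).contDiffAt.isSymmSndFDerivAt_of_omega _ _

theorem jet_congr (hU : IsOpen U) (j : ℕ) {φ ψ : (Fin 5 → ℝ) → ℝ} (h : Set.EqOn φ ψ U)
    {x : Fin 5 → ℝ} (hx : x ∈ U) (ξ : Fin 5 → ℝ) : jet j φ x ξ = jet j ψ x ξ := by
  induction j generalizing φ ψ with
  | zero => exact h hx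
  | succ j ih =>
    simp only [jet]
    exact Finset.sum_congr rfl fun i _ => by rw [ih (partialDeriv_congr hU h i)]

theorem jet_smul (j : ℕ) (φ : (Fin 5 → ℝ) → ℝ) (x ξ : Fin 5 → ℝ) (a : ℝ) :
    jet j φ x (a • ξ) = a ^ j * jet j φ x ξ := by
  induction j generalizing φ with
  | zero => simp [jet]
  | succ j ih =>
    simp only [jet, ih, Finset.mul_sum, Pi.smul_apply, smul_eq_mul]
    exact Finset.sum_congr rfl fun i _ => by ring

theorem analyticAt_jet {E : Type*} [NormedAddCommGroup E] [NormedSpace ℝ E] (j : ℕ)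
    {φ : (Fin 5 → ℝ) → ℝ} (h : AnalyticOnNhd ℝ φ U) {X Ξ : E → Fin 5 → ℝ} {s : E}
    (hX : AnalyticAt ℝ X s) (hs : X s ∈ U) (hΞ : ∀ i, AnalyticAt ℝ (fun r => Ξ r i) s) :
    AnalyticAt ℝ (fun r => jet j φ (X r) (Ξ r)) s := by
  induction j generalizing φ with
  | zero => exact (h _ hs).comp hX
  | succ j ih =>
    simp only [jet]
    exact Finset.analyticAt_fun_sum _ fun i _ => (hΞ i).mul (ih (h.partialDeriv i))

theorem hasDerivAt_jet (hU : IsOpen U) (j : ℕ) {φ : (Fin 5 → ℝ) → ℝ} (h : AnalyticOnNhd ℝ φ U)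
    {X Ξ : ℝ → Fin 5 → ℝ} {X' Ξ' : Fin 5 → ℝ} {t : ℝ}
    (hX : HasDerivAt X X' t) (ht : X t ∈ U) (hΞ : ∀ i, HasDerivAt (fun r => Ξ r i) (Ξ' i) t) :
    HasDerivAt (fun r => jet j φ (X r) (Ξ r))
      (∑ k, X' k * jet j (partialDeriv k φ) (X t) (Ξ t)
        + j * ∑ k, Ξ' k * jet (j - 1) (partialDeriv k φ) (X t) (Ξ t)) t := by
  induction j generalizing φ with
  | zero =>
    have := ((h _ ht).differentiableAt.hasFDerivAt).comp_hasDerivAt t hX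
    rw [fderiv_eq_sum_partialDeriv] at this
    refine (this.congr_deriv ?_ :)
    simp [jet]
  | succ j ih =>
    simp only [jet]
    have hsum := HasDerivAt.fun_sum (u := Finset.univ)
      fun i _ => (hΞ i).fun_mul (ih (h.partialDeriv i))
    refine hsum.congr_deriv ?_
    have comm : ∀ (n : ℕ) (i k : Fin 5),
        jet n (partialDeriv k (partialDeriv i φ)) (X t) (Ξ t)
          = jet n (partialDeriv i (partialDeriv k φ)) (X t) (Ξ t) := fun n i k =>
      jet_congr hU n (partialDeriv_comm h k i) ht _
    have e1 : ∑ i, Ξ t i * ∑ k, X' k * jet j (partialDeriv k (partialDeriv i φ)) (X t) (Ξ t)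
        = ∑ k, X' k * ∑ i, Ξ t i * jet j (partialDeriv i (partialDeriv k φ)) (X t) (Ξ t) := by
      simp only [Finset.mul_sum]
      rw [Finset.sum_comm]
      refine Finset.sum_congr rfl fun k _ => Finset.sum_congr rfl fun i _ => ?_
      rw [comm]; ring
    have e2 : ∑ i, Ξ t i * ((j : ℝ) * ∑ k, Ξ' k *
          jet (j - 1) (partialDeriv k (partialDeriv i φ)) (X t) (Ξ t))
        = j * ∑ k, Ξ' k * jet j (partialDeriv k φ) (X t) (Ξ t) := by
      rcases j with _ | j
      · simp
      · simp only [jet, Finset.mul_sum]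
        rw [Finset.sum_comm]
        refine Finset.sum_congr rfl fun k _ => Finset.sum_congr rfl fun i _ => ?_
        rw [comm]; simp only [Nat.add_sub_cancel]; ring
    simp only [mul_add, Finset.sum_add_distrib]
    rw [e1, e2]
    push_cast
    ring

theorem jet_add (hU : IsOpen U) (j : ℕ) {φ ψ : (Fin 5 → ℝ) → ℝ} (hφ : AnalyticOnNhd ℝ φ U)
    (hψ : AnalyticOnNhd ℝ ψ U) {x : Fin 5 → ℝ} (hx : x ∈ U) (ξ : Fin 5 → ℝ) :
    jet j (fun y => φ y + ψ y) x ξ = jet j φ x ξ + jet j ψ x ξ := by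
  induction j generalizing φ ψ with
  | zero => rfl
  | succ j ih =>
    simp only [jet, ← Finset.sum_add_distrib, ← mul_add]
    refine Finset.sum_congr rfl fun i _ => ?_
    rw [← ih (hφ.partialDeriv i) (hψ.partialDeriv i)]
    congr 1
    refine jet_congr hU j (fun y hy => ?_) hx ξ
    unfold partialDeriv
    rw [fderiv_fun_add (hφ y hy).differentiableAt (hψ y hy).differentiableAt]
    rfl

theorem jet_mul (hU : IsOpen U) (j : ℕ) {φ ψ : (Fin 5 → ℝ) → ℝ} (hφ : AnalyticOnNhd ℝ φ U)
    (hψ : AnalyticOnNhd ℝ ψ U) {x : Fin 5 → ℝ} (hx : x ∈ U) (ξ : Fin 5 → ℝ) :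
    jet j (fun y => φ y * ψ y) x ξ
      = ∑ p ∈ Finset.HasAntidiagonal.antidiagonal j, (j.choose p.1 : ℝ) * (jet p.1 φ x ξ * jet p.2 ψ x ξ) := by
  induction j generalizing φ ψ with
  | zero => simp [jet]
  | succ j ih =>
    rw [Finset.sum_antidiagonal_choose_succ_mul (fun a b => jet a φ x ξ * jet b ψ x ξ)]
    have hstep : ∀ i, jet j (partialDeriv i fun y => φ y * ψ y) x ξ
        = ∑ p ∈ Finset.HasAntidiagonal.antidiagonal j, (j.choose p.1 : ℝ) *
            (jet p.1 φ x ξ * jet p.2 (partialDeriv i ψ) x ξ)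
          + ∑ p ∈ Finset.HasAntidiagonal.antidiagonal j, (j.choose p.1 : ℝ) *
            (jet p.1 (partialDeriv i φ) x ξ * jet p.2 ψ x ξ) := by
      intro i
      rw [← ih hφ (hψ.partialDeriv i), ← ih (hφ.partialDeriv i) hψ,
        ← jet_add hU j (hφ.mul (hψ.partialDeriv i)) ((hφ.partialDeriv i).mul hψ) hx]
      refine jet_congr hU j (fun y hy => ?_) hx ξ
      change fderiv ℝ (fun y => φ y * ψ y) y _ = _
      rw [fderiv_fun_mul (hφ y hy).differentiableAt (hψ y hy).differentiableAt]
      simp [partialDeriv]; ring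
    simp only [jet, hstep, mul_add, Finset.sum_add_distrib]
    congr 1
    · simp only [Finset.mul_sum]
      rw [Finset.sum_comm]
      refine Finset.sum_congr rfl fun p _ => Finset.sum_congr rfl fun i _ => by ring
    · simp only [Finset.mul_sum, Finset.sum_mul]
      rw [Finset.sum_comm]
      refine Finset.sum_congr rfl fun p hp => Finset.sum_congr rfl fun i _ => ?_
      rw [← Nat.choose_symm_of_eq_add (Finset.HasAntidiagonal.mem_antidiagonal.1 hp).symm]
      ring

/-- Leibniz rule when the second factor vanishes to order `j - 1` along `ξ`. -/
theorem jet_mul_of_vanish (hU : IsOpen U) (j : ℕ) {φ ψ : (Fin 5 → ℝ) → ℝ}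
    (hφ : AnalyticOnNhd ℝ φ U) (hψ : AnalyticOnNhd ℝ ψ U) {x : Fin 5 → ℝ} (hx : x ∈ U)
    (ξ : Fin 5 → ℝ) (h0 : ∀ i, i + 1 < j → jet i ψ x ξ = 0) :
    jet j (fun y => φ y * ψ y) x ξ
      = φ x * jet j ψ x ξ + j * (jet 1 φ x ξ * jet (j - 1) ψ x ξ) := by
  rw [jet_mul hU j hφ hψ hx, Finset.Nat.sum_antidiagonal_eq_sum_range_succ_mk]
  rcases j with _ | j
  · simp [jet]
  · rw [Finset.sum_range_succ', Finset.sum_range_succ']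
    rw [Finset.sum_eq_zero]
    · simp [jet]; ring
    · intro k hk
      rw [Finset.mem_range] at hk
      dsimp only
      rw [h0 _ (by omega)]; ring

theorem eventually_eq_zero_of_jet (hU : IsOpen U) {φ : (Fin 5 → ℝ) → ℝ}
    (h : AnalyticOnNhd ℝ φ U) {x : Fin 5 → ℝ} (hx : x ∈ U) (h0 : ∀ j ξ, jet j φ x ξ = 0) :
    ∀ᶠ y in 𝓝 x, φ y = 0 := by
  obtain ⟨r, hr, hball⟩ := Metric.isOpen_iff.1 hU x hx
  filter_upwards [Metric.ball_mem_nhds x hr] with y hy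
  set ξ := y - x with hξ
  set S : Set ℝ := (fun σ : ℝ => x + σ • ξ) ⁻¹' Metric.ball x r with hS
  have hcont : Continuous fun σ : ℝ => x + σ • ξ := by fun_prop
  have hSo : IsOpen S := Metric.isOpen_ball.preimage hcont
  have hSc : Convex ℝ S := by
    intro a ha b hb p q hp hq hpq
    have := (convex_ball x r) ha hb hp hq hpq
    rw [hS, Set.mem_preimage]
    convert this using 1
    simp only [smul_add, smul_smul, smul_eq_mul]
    have : x = (p + q) • x := by rw [hpq, one_smul]
    nth_rewrite 1 [this]
    module
  have h0S : (0 : ℝ) ∈ S := by simp [hS, hr]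
  have h1S : (1 : ℝ) ∈ S := by simpa [hS, hξ] using hy
  have hline : ∀ σ : ℝ, AnalyticAt ℝ (fun σ : ℝ => x + σ • ξ) σ := fun σ => by fun_prop
  have hψ : AnalyticOnNhd ℝ (fun σ : ℝ => φ (x + σ • ξ)) S := fun σ hσ =>
    AnalyticAt.comp (g := φ) (f := fun σ : ℝ => x + σ • ξ) (h _ (hball hσ)) (hline σ)
  have hder : ∀ j, Set.EqOn (iteratedDeriv j fun σ : ℝ => φ (x + σ • ξ))
      (fun σ => jet j φ (x + σ • ξ) ξ) S := by
    intro j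
    induction j with
    | zero => intro σ _; simp [jet]
    | succ j ih =>
      intro σ hσ
      rw [iteratedDeriv_succ, (ih.eventuallyEq_of_mem (hSo.mem_nhds hσ)).deriv_eq]
      have hX : HasDerivAt (fun σ : ℝ => x + σ • ξ) ξ σ := by
        simpa using ((hasDerivAt_id σ).smul_const ξ).const_add x
      have := hasDerivAt_jet hU j h hX (hball hσ) (Ξ := fun _ => ξ) (Ξ' := 0)
        (fun i => hasDerivAt_const _ _)
      rw [this.deriv]
      simp [jet]
  have hp := (hψ 0 h0S).hasFPowerSeriesAt
  have hz : ∀ᶠ σ in 𝓝 (0 : ℝ), φ (x + σ • ξ) = 0 := by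
    have hzero : (FormalMultilinearSeries.ofScalars ℝ
        (fun n => iteratedDeriv n (fun σ : ℝ => φ (x + σ • ξ)) 0 / n.factorial)) = 0 := by
      have : (fun n => iteratedDeriv n (fun σ : ℝ => φ (x + σ • ξ)) 0 / (n.factorial : ℝ)) = 0 := by
        funext n
        rw [hder n h0S]
        simp [h0]
      rw [this]
      exact FormalMultilinearSeries.ofScalars_series_eq_zero_of_scalar_zero ℝ ℝ
    rw [hzero] at hp
    exact hp.eventually_eq_zero
  have := hψ.eqOn_zero_of_preconnected_of_eventuallyEq_zero hSc.isPreconnected h0S hz h1S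
  simpa [hξ] using this

end

section
variable {U : Set (Fin 5 → ℝ)}

/-- The derivative of `φ` along the vector field `f`. -/
noncomputable def lieDeriv (f : (Fin 5 → ℝ) → Fin 5 → ℝ) (φ : (Fin 5 → ℝ) → ℝ)
    (x : Fin 5 → ℝ) : ℝ := ∑ i, f x i * partialDeriv i φ x

theorem lieDeriv_eq_fderiv (f : (Fin 5 → ℝ) → Fin 5 → ℝ) (φ : (Fin 5 → ℝ) → ℝ)
    (x : Fin 5 → ℝ) : lieDeriv f φ x = fderiv ℝ φ x (f x) :=
  (fderiv_eq_sum_partialDeriv φ x (f x)).symm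

theorem jet_sum (hU : IsOpen U) (j : ℕ) {φ : Fin 5 → (Fin 5 → ℝ) → ℝ}
    (hφ : ∀ i, AnalyticOnNhd ℝ (φ i) U) {x : Fin 5 → ℝ} (hx : x ∈ U) (ξ : Fin 5 → ℝ) :
    jet j (fun y => ∑ i, φ i y) x ξ = ∑ i, jet j (φ i) x ξ := by
  have h01 : AnalyticOnNhd ℝ (fun y => φ 0 y + φ 1 y) U := (hφ 0).add (hφ 1)
  have h02 : AnalyticOnNhd ℝ (fun y => φ 0 y + φ 1 y + φ 2 y) U := h01.add (hφ 2)
  have h03 : AnalyticOnNhd ℝ (fun y => φ 0 y + φ 1 y + φ 2 y + φ 3 y) U := h02.add (hφ 3)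
  simp only [Fin.sum_univ_five]
  rw [jet_add hU j h03 (hφ 4) hx, jet_add hU j h02 (hφ 3) hx, jet_add hU j h01 (hφ 2) hx,
    jet_add hU j (hφ 0) (hφ 1) hx]

theorem jet_partialDeriv_eq_zero (hU : IsOpen U) {φ : (Fin 5 → ℝ) → ℝ}
    (h : AnalyticOnNhd ℝ φ U) {x : Fin 5 → ℝ} (hx : x ∈ U) {j : ℕ}
    (h0 : ∀ ξ, jet (j + 1) φ x ξ = 0) (i : Fin 5) (ξ : Fin 5 → ℝ) :
    jet j (partialDeriv i φ) x ξ = 0 := by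
  have hd := hasDerivAt_jet hU (j + 1) h (X := fun _ => x) (X' := 0) (t := 0)
    (Ξ := fun r => ξ + r • Pi.single i 1) (Ξ' := Pi.single i 1) (hasDerivAt_const _ _) hx
    (fun k => by
      simpa using ((hasDerivAt_id (0 : ℝ)).mul_const ((Pi.single i 1 : Fin 5 → ℝ) k)).const_add (ξ k))
  have := hd.unique (by simpa only [h0] using hasDerivAt_const (0 : ℝ) (0 : ℝ))
  simp only [Pi.zero_apply, zero_mul, Finset.sum_const_zero, zero_add, Pi.single_apply, ite_mul,
    one_mul, Finset.sum_ite_eq', Finset.mem_univ, if_true, zero_smul, add_zero,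
    Nat.add_sub_cancel] at this
  have hj : ((j + 1 : ℕ) : ℝ) ≠ 0 := by positivity
  exact (mul_eq_zero.1 this).resolve_left hj

variable {c v : ℝ → Fin 5 → ℝ}

theorem sum_velocity_jet_eq_zero (hU : IsOpen U) {φ : (Fin 5 → ℝ) → ℝ}
    (h : AnalyticOnNhd ℝ φ U) (hc : ∀ t, HasDerivAt c (v t) t) (hcU : ∀ t, c t ∈ U) {j : ℕ}
    (h0 : ∀ t ξ, jet j φ (c t) ξ = 0) (t : ℝ) (ξ : Fin 5 → ℝ) :
    ∑ k, v t k * jet j (partialDeriv k φ) (c t) ξ = 0 := by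
  have hd := hasDerivAt_jet hU j h (hc t) (hcU t) (Ξ := fun _ => ξ) (Ξ' := 0)
    (fun k => hasDerivAt_const _ _)
  have := hd.unique (by simpa only [h0] using hasDerivAt_const (t : ℝ) (0 : ℝ))
  simpa using this

theorem jet_add_smul_velocity (hU : IsOpen U) {φ : (Fin 5 → ℝ) → ℝ}
    (h : AnalyticOnNhd ℝ φ U) (hc : ∀ t, HasDerivAt c (v t) t) (hcU : ∀ t, c t ∈ U) {m : ℕ}
    (h0 : ∀ j < m, ∀ t ξ, jet j φ (c t) ξ = 0) (t : ℝ) (ξ : Fin 5 → ℝ) (κ : ℝ) :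
    jet m φ (c t) (ξ + κ • v t) = jet m φ (c t) ξ := by
  rcases m with _ | m
  · rfl
  have hd : ∀ r : ℝ, HasDerivAt (fun r : ℝ => jet (m + 1) φ (c t) (ξ + r • v t)) 0 r := by
    intro r
    have := hasDerivAt_jet hU (m + 1) h (X := fun _ => c t) (X' := 0) (t := r)
      (Ξ := fun r => ξ + r • v t) (Ξ' := v t) (hasDerivAt_const _ _) (hcU t)
      (fun k => by simpa using ((hasDerivAt_id r).mul_const (v t k)).const_add (ξ k))
    refine this.congr_deriv ?_
    rw [Nat.add_sub_cancel, sum_velocity_jet_eq_zero hU h hc hcU (h0 m (by omega))]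
    simp
  have := is_const_of_deriv_eq_zero (fun r => (hd r).differentiableAt) (fun r => (hd r).deriv) κ 0
  simpa using this

theorem jet_lieDeriv (hU : IsOpen U) {f : (Fin 5 → ℝ) → Fin 5 → ℝ}
    (hf : ∀ i, AnalyticOnNhd ℝ (fun x => f x i) U) {φ : (Fin 5 → ℝ) → ℝ}
    (h : AnalyticOnNhd ℝ φ U) {m : ℕ} {x : Fin 5 → ℝ} (hx : x ∈ U)
    (h0 : ∀ j < m, ∀ ξ, jet j φ x ξ = 0) (ξ : Fin 5 → ℝ) :
    jet m (lieDeriv f φ) x ξ = ∑ i, f x i * jet m (partialDeriv i φ) x ξ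
      + m * ∑ i, jet 1 (fun y => f y i) x ξ * jet (m - 1) (partialDeriv i φ) x ξ := by
  have := jet_sum hU m (φ := fun i y => f y i * partialDeriv i φ y)
    (fun i => (hf i).mul (h.partialDeriv i)) hx ξ
  change jet m (fun y => ∑ i, f y i * partialDeriv i φ y) x ξ = _
  rw [this, Finset.mul_sum, ← Finset.sum_add_distrib]
  refine Finset.sum_congr rfl fun i _ => ?_
  exact jet_mul_of_vanish hU m (hf i) (h.partialDeriv i) hx ξ
    fun j hj => jet_partialDeriv_eq_zero hU h hx (h0 (j + 1) hj) i ξ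

/-- Along an orbit on which the lower jets of `φ` vanish, the leading jet evolves by the
variational equation modulo the flow direction. -/
theorem hasDerivAt_jet_of_variational (hU : IsOpen U) {f : (Fin 5 → ℝ) → Fin 5 → ℝ}
    (hf : ∀ i, AnalyticOnNhd ℝ (fun x => f x i) U) {φ : (Fin 5 → ℝ) → ℝ}
    (h : AnalyticOnNhd ℝ φ U) (hc : ∀ t, HasDerivAt c (f (c t)) t) (hcU : ∀ t, c t ∈ U) {m : ℕ}
    (h0 : ∀ j < m, ∀ t ξ, jet j φ (c t) ξ = 0) {Ξ : ℝ → Fin 5 → ℝ} {κ t : ℝ}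
    (hΞ : ∀ i, HasDerivAt (fun r => Ξ r i)
      (jet 1 (fun y => f y i) (c t) (Ξ t) + κ * f (c t) i) t) :
    HasDerivAt (fun r => jet m φ (c r) (Ξ r)) (jet m (lieDeriv f φ) (c t) (Ξ t)) t := by
  refine (hasDerivAt_jet hU m h (hc t) (hcU t) hΞ).congr_deriv ?_
  rw [jet_lieDeriv hU hf h (hcU t) (fun j hj => h0 j hj t)]
  congr 1
  rcases m with _ | m
  · simp
  have := sum_velocity_jet_eq_zero (v := fun t => f (c t)) hU h hc hcU (h0 m (by omega)) t (Ξ t)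
  simp only [add_mul, mul_assoc, Finset.sum_add_distrib, ← Finset.mul_sum, Nat.add_sub_cancel]
  rw [this]; ring

end

/-- First coordinate of the homoclinic orbit. -/
noncomputable def hom₁ (t : ℝ) : ℝ := Real.sqrt 2 * (Real.cosh t)⁻¹

/-- Second coordinate of the homoclinic orbit, the derivative of `hom₁`. -/
noncomputable def hom₂ (t : ℝ) : ℝ := -(Real.sqrt 2 * (Real.cosh t)⁻¹ * Real.tanh t)

/-- The derivative of `hom₂`. -/
noncomputable def hom₃ (t : ℝ) : ℝ := hom₁ t - hom₁ t ^ 3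

/-- Squared speed along the homoclinic orbit. -/
noncomputable def homSpeedSq (t : ℝ) : ℝ := hom₂ t ^ 2 + hom₃ t ^ 2

/-- The homoclinic orbit in `ℝ⁵`. -/
noncomputable def homOrbit (t : ℝ) : Fin 5 → ℝ := ![hom₁ t, hom₂ t, 0, 0, 0]

theorem hom₁_pos (t : ℝ) : 0 < hom₁ t := by
  have := Real.cosh_pos t
  unfold hom₁; positivity

theorem hasDerivAt_tanh (t : ℝ) : HasDerivAt Real.tanh (1 - Real.tanh t ^ 2) t := by
  have hc := (Real.cosh_pos t).ne'
  have := (Real.hasDerivAt_sinh t).div (Real.hasDerivAt_cosh t) hc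
  have e : Real.tanh = Real.sinh / Real.cosh := by
    funext x; simp [Real.tanh_eq_sinh_div_cosh]
  rw [e]
  refine this.congr_deriv ?_
  rw [Pi.div_apply]
  field_simp

theorem one_sub_tanh_sq (t : ℝ) : 1 - Real.tanh t ^ 2 = (Real.cosh t)⁻¹ ^ 2 := by
  have hc := (Real.cosh_pos t).ne'
  rw [Real.tanh_eq_sinh_div_cosh]
  field_simp
  linarith [Real.cosh_sq t]

theorem hasDerivAt_hom₁ (t : ℝ) : HasDerivAt hom₁ (hom₂ t) t := by
  have hc := (Real.cosh_pos t).ne'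
  refine (((Real.hasDerivAt_cosh t).inv hc).const_mul (Real.sqrt 2)).congr_deriv ?_
  rw [hom₂, Real.tanh_eq_sinh_div_cosh]
  field_simp

theorem hasDerivAt_hom₂ (t : ℝ) : HasDerivAt hom₂ (hom₃ t) t := by
  have h := ((hasDerivAt_hom₁ t).mul (hasDerivAt_tanh t)).neg
  refine h.congr_deriv ?_
  have h2 : Real.sqrt 2 ^ 2 = 2 := Real.sq_sqrt (by norm_num)
  have e1 : hom₂ t = -(hom₁ t * Real.tanh t) := rfl
  have e2 : hom₁ t ^ 2 = 2 * (1 - Real.tanh t ^ 2) := by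
    rw [one_sub_tanh_sq, hom₁, mul_pow, h2]
  rw [e1, hom₃]
  linear_combination (hom₁ t) * e2

theorem hasDerivAt_hom₃ (t : ℝ) : HasDerivAt hom₃ ((1 - 3 * hom₁ t ^ 2) * hom₂ t) t := by
  have h := (hasDerivAt_hom₁ t).sub ((hasDerivAt_hom₁ t).pow 3)
  refine h.congr_deriv ?_
  norm_num
  ring

theorem hom₂_sq (t : ℝ) : hom₂ t ^ 2 = hom₁ t ^ 2 - hom₁ t ^ 4 / 2 := by
  have h2 : Real.sqrt 2 ^ 2 = 2 := Real.sq_sqrt (by norm_num)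
  have e1 : hom₂ t = -(hom₁ t * Real.tanh t) := rfl
  have e2 : hom₁ t ^ 2 = 2 * (1 - Real.tanh t ^ 2) := by
    rw [one_sub_tanh_sq, hom₁, mul_pow, h2]
  rw [e1]
  linear_combination (hom₁ t ^ 2 / 2) * e2

theorem homSpeedSq_pos (t : ℝ) : 0 < homSpeedSq t := by
  have h1 := hom₁_pos t
  rcases eq_or_ne (hom₂ t) 0 with h | h
  · have h3 : hom₃ t ≠ 0 := by
      have := hom₂_sq t
      rw [h] at this
      have e : hom₁ t ^ 2 * (1 - hom₁ t ^ 2 / 2) = 0 := by linear_combination -this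
      have e2 : hom₁ t ^ 2 = 2 := by
        rcases mul_eq_zero.1 e with h' | h'
        · exact absurd h' (by positivity)
        · linarith
      have : hom₃ t = -hom₁ t := by rw [hom₃]; linear_combination (-hom₁ t) * e2
      rw [this]; exact neg_ne_zero.2 h1.ne'
    unfold homSpeedSq; positivity
  · unfold homSpeedSq; positivity

theorem hasDerivAt_homSpeedSq (t : ℝ) :
    HasDerivAt homSpeedSq (2 * hom₂ t * hom₃ t * (2 - 3 * hom₁ t ^ 2)) t := by
  refine (((hasDerivAt_hom₂ t).pow 2).add ((hasDerivAt_hom₃ t).pow 2)).congr_deriv ?_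
  norm_num
  ring

theorem continuous_hom₂ : Continuous hom₂ :=
  continuous_iff_continuousAt.2 fun t => (hasDerivAt_hom₂ t).continuousAt

/-- Cosine part of the running Melnikov integral. -/
noncomputable def melCos (ω t : ℝ) : ℝ := ∫ τ in (0 : ℝ)..t, hom₂ τ * Real.cos (ω * τ)

/-- Sine part of the running Melnikov integral. -/
noncomputable def melSin (ω t : ℝ) : ℝ := ∫ τ in (0 : ℝ)..t, hom₂ τ * Real.sin (ω * τ)

theorem hasDerivAt_melCos (ω t : ℝ) :
    HasDerivAt (melCos ω) (hom₂ t * Real.cos (ω * t)) t := by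
  have hc : Continuous fun τ => hom₂ τ * Real.cos (ω * τ) :=
    continuous_hom₂.mul (by fun_prop)
  exact intervalIntegral.integral_hasDerivAt_right (hc.intervalIntegrable _ _)
    (hc.stronglyMeasurableAtFilter _ _) hc.continuousAt

theorem hasDerivAt_melSin (ω t : ℝ) :
    HasDerivAt (melSin ω) (hom₂ t * Real.sin (ω * t)) t := by
  have hc : Continuous fun τ => hom₂ τ * Real.sin (ω * τ) :=
    continuous_hom₂.mul (by fun_prop)
  exact intervalIntegral.integral_hasDerivAt_right (hc.intervalIntegrable _ _)
    (hc.stronglyMeasurableAtFilter _ _) hc.continuousAt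

theorem hom₁_neg (t : ℝ) : hom₁ (-t) = hom₁ t := by simp [hom₁]

theorem hom₂_neg (t : ℝ) : hom₂ (-t) = -hom₂ t := by simp [hom₂]

theorem melCos_neg (ω t : ℝ) : melCos ω (-t) = melCos ω t := by
  have hd : ∀ r, HasDerivAt (fun r => melCos ω (-r) - melCos ω r) 0 r := by
    intro r
    have h1 := (hasDerivAt_melCos ω (-r)).comp r (hasDerivAt_neg r)
    refine (h1.sub (hasDerivAt_melCos ω r)).congr_deriv ?_
    rw [hom₂_neg]; simp
  have := is_const_of_deriv_eq_zero (fun r => (hd r).differentiableAt) (fun r => (hd r).deriv) t 0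
  simp only [neg_zero, sub_self] at this
  linarith

theorem melSin_neg (ω t : ℝ) : melSin ω (-t) = -melSin ω t := by
  have hd : ∀ r, HasDerivAt (fun r => melSin ω (-r) + melSin ω r) 0 r := by
    intro r
    have h1 := (hasDerivAt_melSin ω (-r)).comp r (hasDerivAt_neg r)
    refine (h1.add (hasDerivAt_melSin ω r)).congr_deriv ?_
    rw [hom₂_neg]; simp
  have := is_const_of_deriv_eq_zero (fun r => (hd r).differentiableAt) (fun r => (hd r).deriv) t 0
  simp only [neg_zero] at this
  have h0 : melSin ω 0 = 0 := by simp [melSin]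
  rw [h0] at this
  linarith

/-- Normal amplitude of the solution of the variational equation with the given data. -/
noncomputable def varAmp (β δ ω b e p q t : ℝ) : ℝ :=
  b + β * (p * melCos ω t - q * melSin ω t) - δ * e * (2 / 3 * Real.tanh t ^ 3)

/-- Real part of `(p + i q) exp (i ω t)`. -/
noncomputable def rotRe (ω p q t : ℝ) : ℝ := p * Real.cos (ω * t) - q * Real.sin (ω * t)

/-- Imaginary part of `(p + i q) exp (i ω t)`. -/
noncomputable def rotIm (ω p q t : ℝ) : ℝ := p * Real.sin (ω * t) + q * Real.cos (ω * t)

/-- A solution of the variational equation along the homoclinic orbit, modulo the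
flow direction. -/
noncomputable def varSol (β δ ω b e p q t : ℝ) : Fin 5 → ℝ :=
  ![varAmp β δ ω b e p q t * (-hom₃ t / homSpeedSq t),
    varAmp β δ ω b e p q t * (hom₂ t / homSpeedSq t), e, rotRe ω p q t, rotIm ω p q t]

theorem hasDerivAt_rotRe (ω p q t : ℝ) :
    HasDerivAt (rotRe ω p q) (-(ω * rotIm ω p q t)) t := by
  have hω : HasDerivAt (fun t : ℝ => ω * t) ω t := by
    simpa using (hasDerivAt_id t).const_mul ω
  refine ((hω.cos.const_mul p).sub (hω.sin.const_mul q)).congr_deriv ?_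
  rw [rotIm]; ring

theorem hasDerivAt_rotIm (ω p q t : ℝ) :
    HasDerivAt (rotIm ω p q) (ω * rotRe ω p q t) t := by
  have hω : HasDerivAt (fun t : ℝ => ω * t) ω t := by
    simpa using (hasDerivAt_id t).const_mul ω
  refine ((hω.sin.const_mul p).add (hω.cos.const_mul q)).congr_deriv ?_
  rw [rotRe]; ring

theorem hasDerivAt_varAmp (β δ ω b e p q t : ℝ) :
    HasDerivAt (varAmp β δ ω b e p q)
      (hom₂ t * (β * rotRe ω p q t - δ * hom₂ t * e)) t := by
  have h := ((((hasDerivAt_melCos ω t).const_mul p).sub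
    ((hasDerivAt_melSin ω t).const_mul q)).const_mul β).const_add b
  have h' := (((hasDerivAt_tanh t).pow 3).const_mul (2 / 3)).const_mul (δ * e)
  refine (h.sub h').congr_deriv ?_
  have h2 : Real.sqrt 2 ^ 2 = 2 := Real.sq_sqrt (by norm_num)
  have e1 : hom₂ t ^ 2 = 2 * Real.tanh t ^ 2 * (1 - Real.tanh t ^ 2) := by
    rw [one_sub_tanh_sq, hom₂]
    linear_combination ((Real.cosh t)⁻¹ ^ 2 * Real.tanh t ^ 2) * h2
  rw [rotRe]
  norm_num
  linear_combination (δ * e) * e1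

theorem analyticOnNhd_duffingField (β δ ω : ℝ) (U : Set (Fin 5 → ℝ)) (i : Fin 5) :
    AnalyticOnNhd ℝ (fun x => duffingField β δ ω x i) U := by
  intro x _
  have h : ∀ k : Fin 5, AnalyticAt ℝ (fun y : Fin 5 → ℝ => y k) x := fun k =>
    (ContinuousLinearMap.proj (R := ℝ) (φ := fun _ : Fin 5 => ℝ) k).analyticAt x
  have h0 := h 0
  have h1 := h 1
  have h2 := h 2
  have h3 := h 3
  have h4 := h 4
  fin_cases i
  · exact h1
  · change AnalyticAt ℝ (fun x : Fin 5 → ℝ => x 0 - x 0 ^ 3 - x 2 * δ * x 1 + β * x 3) x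
    exact ((h0.sub (h0.pow 3)).sub ((h2.mul analyticAt_const).mul h1)).add
      (analyticAt_const.mul h3)
  · exact analyticAt_const
  · change AnalyticAt ℝ (fun x : Fin 5 → ℝ => -(ω * x 4)) x
    exact (analyticAt_const.mul h4).neg
  · change AnalyticAt ℝ (fun x : Fin 5 → ℝ => ω * x 3) x
    exact analyticAt_const.mul h3

theorem fderiv_duffingField_apply (β δ ω : ℝ) (x ξ : Fin 5 → ℝ) (i : Fin 5) :
    fderiv ℝ (fun y => duffingField β δ ω y i) x ξ
      = ![ξ 1, (1 - 3 * x 0 ^ 2) * ξ 0 - δ * (x 1 * ξ 2 + x 2 * ξ 1) + β * ξ 3, 0,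
          -(ω * ξ 4), ω * ξ 3] i := by
  have h : ∀ k : Fin 5, HasFDerivAt (fun y : Fin 5 → ℝ => y k)
      (ContinuousLinearMap.proj (R := ℝ) (φ := fun _ : Fin 5 => ℝ) k) x := fun k =>
    (ContinuousLinearMap.proj (R := ℝ) (φ := fun _ : Fin 5 => ℝ) k).hasFDerivAt
  fin_cases i
  · change fderiv ℝ (fun y : Fin 5 → ℝ => y 1) x ξ = ξ 1
    rw [(h 1).fderiv]; rfl
  · change fderiv ℝ (fun x : Fin 5 → ℝ => x 0 - x 0 ^ 3 - x 2 * δ * x 1 + β * x 3) x ξ = _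
    rw [((((h 0).fun_sub ((h 0).pow 3)).fun_sub (((h 2).mul_const δ).fun_mul (h 1))).fun_add
      ((h 3).const_mul β)).fderiv]
    simp
    ring
  · change fderiv ℝ (fun y : Fin 5 → ℝ => (0 : ℝ)) x ξ = 0
    simp
  · change fderiv ℝ (fun x : Fin 5 → ℝ => -(ω * x 4)) x ξ = -(ω * ξ 4)
    rw [((h 4).const_mul ω).fun_neg.fderiv]
    simp
  · change fderiv ℝ (fun x : Fin 5 → ℝ => ω * x 3) x ξ = ω * ξ 3
    rw [((h 3).const_mul ω).fderiv]
    simp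

theorem duffingField_homOrbit (β δ ω t : ℝ) :
    duffingField β δ ω (homOrbit t) = ![hom₂ t, hom₃ t, 0, 0, 0] := by
  funext i
  fin_cases i <;> simp [duffingField, homOrbit, hom₃]

theorem hasDerivAt_homOrbit (β δ ω t : ℝ) :
    HasDerivAt homOrbit (duffingField β δ ω (homOrbit t)) t := by
  rw [duffingField_homOrbit, hasDerivAt_pi]
  intro i
  fin_cases i
  · exact hasDerivAt_hom₁ t
  · exact hasDerivAt_hom₂ t
  all_goals exact hasDerivAt_const _ _

theorem exists_hasDerivAt_varSol (β δ ω b e p q t : ℝ) : ∃ κ : ℝ, ∀ i,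
    HasDerivAt (fun r => varSol β δ ω b e p q r i)
      (jet 1 (fun y => duffingField β δ ω y i) (homOrbit t) (varSol β δ ω b e p q t)
        + κ * duffingField β δ ω (homOrbit t) i) t := by
  have hΔ := (homSpeedSq_pos t).ne'
  have hA := hasDerivAt_varAmp β δ ω b e p q t
  refine ⟨varAmp β δ ω b e p q t * ((2 - 3 * hom₁ t ^ 2) * (hom₃ t ^ 2 - hom₂ t ^ 2)
    / homSpeedSq t ^ 2) - (β * rotRe ω p q t - δ * hom₂ t * e) * hom₃ t / homSpeedSq t,
    fun i => ?_⟩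
  rw [jet_one, fderiv_duffingField_apply, duffingField_homOrbit]
  fin_cases i
  · have h := hA.mul ((hasDerivAt_hom₃ t).neg.div (hasDerivAt_homSpeedSq t) hΔ)
    refine h.congr_deriv ?_
    simp [varSol]
    field_simp
    simp only [homSpeedSq]
    ring
  · have h := hA.mul ((hasDerivAt_hom₂ t).div (hasDerivAt_homSpeedSq t) hΔ)
    refine h.congr_deriv ?_
    simp [varSol, homOrbit]
    field_simp
    simp only [homSpeedSq]
    ring
  · exact (hasDerivAt_const _ _).congr_deriv (by simp)
  · exact (hasDerivAt_rotRe ω p q t).congr_deriv (by simp [varSol])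
  · exact (hasDerivAt_rotIm ω p q t).congr_deriv (by simp [varSol])

theorem exists_eq_varSol (β δ ω t : ℝ) (ξ : Fin 5 → ℝ) : ∃ b p q κ : ℝ,
    ξ = varSol β δ ω b (ξ 2) p q t + κ • duffingField β δ ω (homOrbit t) ∧
      p ^ 2 + q ^ 2 = ξ 3 ^ 2 + ξ 4 ^ 2 := by
  have hΔ := (homSpeedSq_pos t).ne'
  have hcs := Real.cos_sq_add_sin_sq (ω * t)
  set C := Real.cos (ω * t) with hC
  set S := Real.sin (ω * t) with hS
  set p := ξ 3 * C + ξ 4 * S with hp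
  set q := ξ 4 * C - ξ 3 * S with hq
  set b := (-hom₃ t * ξ 0 + hom₂ t * ξ 1) -
    (β * (p * melCos ω t - q * melSin ω t) - δ * ξ 2 * (2 / 3 * Real.tanh t ^ 3)) with hb
  have hamp : varAmp β δ ω b (ξ 2) p q t = -hom₃ t * ξ 0 + hom₂ t * ξ 1 := by
    rw [varAmp, hb]; ring
  refine ⟨b, p, q, (hom₂ t * ξ 0 + hom₃ t * ξ 1) / homSpeedSq t, ?_, ?_⟩
  · rw [duffingField_homOrbit]
    funext i
    fin_cases i
    · simp [varSol, hamp]; field_simp; simp only [homSpeedSq]; ring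
    · simp [varSol, hamp]; field_simp; simp only [homSpeedSq]; ring
    · simp [varSol]
    · simp [varSol, rotRe, ← hC, ← hS]; rw [hp, hq]; linear_combination (-ξ 3) * hcs
    · simp [varSol, rotIm, ← hC, ← hS]; rw [hp, hq]; linear_combination (-ξ 4) * hcs
  · rw [hp, hq]; linear_combination (ξ 3 ^ 2 + ξ 4 ^ 2) * hcs

theorem exists_differentiableOn_resonance_free (μ : ℂ) {r : ℝ} (hr : 0 < r)
    (hμ : ∀ n : ℕ, r ≤ ‖μ - 2 * n‖) :
    ∃ g : ℂ → ℂ, DifferentiableOn ℂ g (Metric.ball 0 (1 / 2)) ∧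
      ∀ z ∈ Metric.ball (0 : ℂ) (1 / 2), μ * g z - z * deriv g z = 1 / (1 + z ^ 2) := by
  set F : ℕ → ℂ → ℂ := fun n z => (-z ^ 2) ^ n / (μ - 2 * n) with hF
  have hμ0 : ∀ n : ℕ, μ - 2 * n ≠ 0 := fun n => norm_pos_iff.1 (hr.trans_le (hμ n))
  have hz2 : ∀ z ∈ Metric.ball (0 : ℂ) (1 / 2), ‖-z ^ 2‖ ≤ 1 / 4 := by
    intro z hz
    rw [mem_ball_zero_iff] at hz
    rw [norm_neg, norm_pow]
    nlinarith [norm_nonneg z]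
  have hu : Summable fun n : ℕ => (1 / 4 : ℝ) ^ n / r :=
    (summable_geometric_of_lt_one (by norm_num) (by norm_num)).div_const r
  have hdiff : ∀ n, DifferentiableOn ℂ (F n) (Metric.ball 0 (1 / 2)) := fun n => by
    intro z _
    exact ((((differentiableAt_id.pow 2).neg).pow n).div_const _).differentiableWithinAt
  have hbound : ∀ n, ∀ z ∈ Metric.ball (0 : ℂ) (1 / 2), ‖F n z‖ ≤ (1 / 4 : ℝ) ^ n / r := by
    intro n z hz
    rw [hF]
    simp only [norm_div, norm_pow]
    gcongr
    · exact hz2 z hz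
    · exact hμ n
  refine ⟨fun z => ∑' n, F n z, ?_, fun z hz => ?_⟩
  · exact Complex.differentiableOn_tsum_of_summable_norm hu hdiff Metric.isOpen_ball hbound
  have h1 := Complex.hasSum_deriv_of_summable_norm hu hdiff Metric.isOpen_ball hbound hz
  have h2 : HasSum (fun n => F n z) (∑' n, F n z) :=
    (Summable.of_norm_bounded hu fun n => hbound n z hz).hasSum
  have h3 := (h2.mul_left μ).sub (h1.mul_left z)
  have h4 : HasSum (fun n : ℕ => (-z ^ 2) ^ n) (1 - -z ^ 2)⁻¹ :=
    hasSum_geometric_of_norm_lt_one ((hz2 z hz).trans_lt (by norm_num))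
  have h5 : (fun n => μ * F n z - z * deriv (F n) z) = fun n => (-z ^ 2) ^ n := by
    funext n
    have hd : HasDerivAt (F n) (n * (-z ^ 2) ^ (n - 1) * (-(2 * z)) / (μ - 2 * n)) z := by
      have := (((hasDerivAt_pow 2 z).neg).pow n).div_const (μ - 2 * n)
      refine (this.congr_deriv ?_ :)
      simp
    rw [hd.deriv]
    have hm := hμ0 n
    simp only [hF]
    field_simp
    rcases n with _ | n
    · simp
    · simp only [Nat.add_sub_cancel]; push_cast; ring
  rw [h5] at h3
  have h6 := h3.unique h4
  rw [h6]
  simp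

theorem hom₁_eq_exp (t : ℝ) :
    hom₁ t = Real.exp (-t) * (2 * Real.sqrt 2 / (1 + Real.exp (-t) ^ 2)) := by
  rw [hom₁, Real.cosh_eq]
  have h : Real.exp t = (Real.exp (-t))⁻¹ := by rw [Real.exp_neg, inv_inv]
  rw [h]
  have := Real.exp_pos (-t)
  field_simp

/-- Behaviour of the running Melnikov integrals as `t → ∞`. -/
theorem exists_melnikov_asymptotics {ω : ℝ} (hω : 0 < ω) : ∃ (gr gi : ℝ → ℝ) (Mc Ms : ℝ),
    AnalyticAt ℝ gr 0 ∧ AnalyticAt ℝ gi 0 ∧ ∀ t : ℝ, Real.log 2 < t →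
      melCos ω t = Mc + Real.exp (-t) * (Real.cos (ω * t) * gr (Real.exp (-t))
        - Real.sin (ω * t) * gi (Real.exp (-t))) ∧
      melSin ω t = Ms + Real.exp (-t) * (Real.cos (ω * t) * gi (Real.exp (-t))
        + Real.sin (ω * t) * gr (Real.exp (-t))) := by
  set μ : ℂ := Complex.I * ω - 1 with hμ
  obtain ⟨g, hg, hode⟩ := exists_differentiableOn_resonance_free μ hω (fun n => by
    have : ω = (μ - 2 * n).im := by simp [hμ]
    calc ω ≤ |(μ - 2 * n).im| := by rw [← this]; exact le_abs_self _
      _ ≤ _ := Complex.abs_im_le_norm _)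
  set G : ℂ → ℂ := fun z => 2 * Real.sqrt 2 / (1 + z ^ 2) - Complex.I * ω * (2 * Real.sqrt 2) * g z
    with hG
  have hGan : AnalyticAt ℂ G 0 := by
    have h1 : AnalyticAt ℂ g 0 := hg.analyticAt (Metric.ball_mem_nhds _ (by norm_num))
    have h2 : AnalyticAt ℂ (fun z : ℂ => 2 * (Real.sqrt 2 : ℂ) / (1 + z ^ 2)) 0 :=
      analyticAt_const.div (analyticAt_const.add (analyticAt_id.pow 2)) (by simp)
    exact h2.sub (analyticAt_const.mul h1)
  have hGr : AnalyticAt ℝ (fun s : ℝ => G (s : ℂ)) 0 := by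
    have h1 : AnalyticAt ℝ (fun s : ℝ => (s : ℂ)) 0 := Complex.ofRealCLM.analyticAt 0
    have h2 : AnalyticAt ℝ G ((0 : ℝ) : ℂ) := by
      simpa using hGan.restrictScalars (𝕜 := ℝ)
    exact AnalyticAt.comp (g := G) (f := fun s : ℝ => (s : ℂ)) h2 h1
  set R : ℝ → ℂ := fun t => Complex.exp (Complex.I * ω * t) * (Real.exp (-t) : ℝ)
    * G (Real.exp (-t) : ℝ) with hR
  set Q : ℝ → ℂ := fun t => (melCos ω t : ℂ) + Complex.I * melSin ω t with hQ
  have hexp : ∀ t : ℝ, Complex.exp (Complex.I * ω * t)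
      = Real.cos (ω * t) + Complex.I * Real.sin (ω * t) := by
    intro t
    have : Complex.I * ω * t = ((ω * t : ℝ) : ℂ) * Complex.I := by push_cast; ring
    rw [this, Complex.exp_mul_I, Complex.ofReal_cos, Complex.ofReal_sin]; ring
  have hQd : ∀ t, HasDerivAt Q ((hom₂ t : ℂ) * Complex.exp (Complex.I * ω * t)) t := by
    intro t
    refine ((hasDerivAt_melCos ω t).ofReal_comp.add
      ((hasDerivAt_melSin ω t).ofReal_comp.const_mul Complex.I)).congr_deriv ?_
    rw [hexp]; push_cast; ring
  have hmem : ∀ t : ℝ, Real.log 2 < t → ((Real.exp (-t) : ℝ) : ℂ) ∈ Metric.ball (0 : ℂ) (1 / 2) := by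
    intro t ht
    rw [mem_ball_zero_iff, Complex.norm_real, Real.norm_eq_abs, abs_of_pos (Real.exp_pos _)]
    calc Real.exp (-t) < Real.exp (-Real.log 2) := Real.exp_lt_exp.2 (by linarith)
      _ = 1 / 2 := by rw [Real.exp_neg, Real.exp_log (by norm_num)]; norm_num
  have hRd : ∀ t : ℝ, Real.log 2 < t →
      HasDerivAt R ((hom₂ t : ℂ) * Complex.exp (Complex.I * ω * t)) t := by
    intro t ht
    set s : ℝ := Real.exp (-t) with hs
    have hsd : HasDerivAt (fun t : ℝ => Real.exp (-t)) (-s) t := by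
      simpa using (hasDerivAt_neg t).exp
    have hsd' : HasDerivAt (fun t : ℝ => ((Real.exp (-t) : ℝ) : ℂ)) (-s : ℂ) t := by
      simpa using hsd.ofReal_comp
    have hgd : HasDerivAt (fun t : ℝ => g (Real.exp (-t) : ℝ)) (deriv g s * (-s : ℂ)) t :=
      HasDerivAt.comp t (h₂ := g) ((hg.differentiableAt
        (Metric.isOpen_ball.mem_nhds (hmem t ht))).hasDerivAt) hsd'
    have hE : HasDerivAt (fun t : ℝ => Complex.exp (Complex.I * ω * t))
        (Complex.exp (Complex.I * ω * t) * (Complex.I * ω)) t := by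
      have h1 : HasDerivAt (fun t : ℝ => Complex.I * ω * (t : ℂ)) (Complex.I * ω) t := by
        simpa using ((hasDerivAt_id t).ofReal_comp).const_mul (Complex.I * ω)
      exact h1.cexp
    have hR' : R = fun t : ℝ => Complex.exp (Complex.I * ω * t) * (hom₁ t : ℂ)
        - (Complex.I * ω * (2 * Real.sqrt 2)) * (Complex.exp (Complex.I * ω * t)
          * ((Real.exp (-t) : ℝ) * g (Real.exp (-t) : ℝ))) := by
      funext t
      rw [hR, hG, hom₁_eq_exp]
      push_cast
      ring
    rw [hR']
    refine ((hE.mul (hasDerivAt_hom₁ t).ofReal_comp).sub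
      ((hE.mul (hsd'.fun_mul hgd)).const_mul (Complex.I * ω * (2 * Real.sqrt 2)))).congr_deriv ?_
    have hod := hode s (hmem t ht)
    have h1 : (hom₁ t : ℂ) = s * (2 * Real.sqrt 2 / (1 + s ^ 2)) := by
      rw [hom₁_eq_exp, ← hs]; push_cast; rfl
    rw [h1]
    rw [hμ] at hod
    linear_combination (-Complex.I * ω * (2 * Real.sqrt 2) * Complex.exp (Complex.I * ω * t) * s) * hod
  set t₁ : ℝ := Real.log 2 + 1 with ht₁
  have hconst : ∀ t : ℝ, Real.log 2 < t → Q t - R t = Q t₁ - R t₁ := by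
    intro t ht
    have hd : ∀ r ∈ Set.Ioi (Real.log 2), HasDerivAt (fun t => Q t - R t) 0 r := fun r hr =>
      ((hQd r).sub (hRd r hr)).congr_deriv (sub_self _)
    exact isOpen_Ioi.is_const_of_deriv_eq_zero (convex_Ioi _).isPreconnected
      (fun r hr => (hd r hr).differentiableAt.differentiableWithinAt)
      (fun r hr => (hd r hr).deriv) ht (by simp [ht₁])
  refine ⟨fun s => (G s).re, fun s => (G s).im, (Q t₁ - R t₁).re, (Q t₁ - R t₁).im,
    AnalyticAt.comp (g := Complex.re) (Complex.reCLM.analyticAt _) hGr,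
    AnalyticAt.comp (g := Complex.im) (Complex.imCLM.analyticAt _) hGr, fun t ht => ?_⟩
  have hq : Q t = (Q t₁ - R t₁) + R t := by rw [← hconst t ht]; ring
  have hre := congrArg Complex.re hq
  have him := congrArg Complex.im hq
  simp only [hQ, hR, hexp] at hre him
  simp [-Complex.ofReal_exp, -Complex.ofReal_cos, -Complex.ofReal_sin] at hre him
  simp [-Complex.ofReal_exp, -Complex.ofReal_cos, -Complex.ofReal_sin, hQ, hR, hexp]
  constructor
  · rw [hre]; ring
  · rw [him]; ring

theorem fourier_sech_integrable_and_ne_zero (ω : ℝ) :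
    Integrable (fun t : ℝ => ((Real.cosh t)⁻¹ : ℂ) * Complex.exp (Complex.I * ω * t)) ∧
    ∫ t : ℝ, ((Real.cosh t)⁻¹ : ℂ) * Complex.exp (Complex.I * ω * t) ≠ 0 := by
  set u : ℂ := (1 + Complex.I * ω) / 2 with hu
  set v : ℂ := (1 - Complex.I * ω) / 2 with hv
  have hure : 0 < u.re := by simp [hu]
  have hvre : 0 < v.re := by simp [hv]
  set f : ℝ → ℝ := fun t => (1 + Real.exp (-2 * t))⁻¹ with hf
  set f' : ℝ → ℝ := fun t => 2 * Real.exp (-2 * t) * f t ^ 2 with hf'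
  have hpos : ∀ t, 0 < f t := fun t => by simp only [hf]; positivity
  have hone : ∀ t, 1 - f t = Real.exp (-2 * t) * f t := fun t => by
    simp only [hf]; have := Real.exp_pos (-2 * t); field_simp; ring
  have hder : ∀ t ∈ Set.univ, HasDerivWithinAt f (f' t) Set.univ t := by
    intro t _
    have h1 : HasDerivAt (fun t : ℝ => 1 + Real.exp (-2 * t)) (Real.exp (-2 * t) * -2) t := by
      have : HasDerivAt (fun t : ℝ => -2 * t) (-2) t := by
        simpa using (hasDerivAt_id t).const_mul (-2 : ℝ)
      exact this.exp.const_add 1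
    have h2 := h1.inv (by positivity)
    refine (h2.congr_deriv ?_).hasDerivWithinAt
    simp only [hf', hf]; field_simp
  have hinj : Set.InjOn f Set.univ := by
    intro a _ b _ hab
    simp only [hf] at hab
    have := inv_injective hab
    have h2 : Real.exp (-2 * a) = Real.exp (-2 * b) := by linarith
    have := Real.exp_injective h2
    linarith
  have himg : f '' Set.univ = Set.Ioo 0 1 := by
    ext x
    constructor
    · rintro ⟨t, -, rfl⟩
      have := Real.exp_pos (-2 * t)
      refine ⟨hpos t, ?_⟩
      have := hone t
      have := mul_pos (Real.exp_pos (-2 * t)) (hpos t)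
      linarith
    · rintro ⟨h0, h1⟩
      refine ⟨-(Real.log (1 / x - 1)) / 2, trivial, ?_⟩
      have hx : 0 < 1 / x - 1 := by
        rw [sub_pos, lt_div_iff₀ h0]; linarith
      simp only [hf]
      have : -2 * (-(Real.log (1 / x - 1)) / 2) = Real.log (1 / x - 1) := by ring
      rw [this, Real.exp_log hx]
      field_simp
      ring
  set g : ℝ → ℂ := fun x => (x : ℂ) ^ (u - 1) * (1 - (x : ℂ)) ^ (v - 1) with hg
  have h_int : ∀ t : ℝ, |f' t| • g (f t)
      = ((Real.cosh t)⁻¹ : ℂ) * Complex.exp (Complex.I * ω * t) := by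
    intro t
    have hf'pos : 0 < f' t := by
      have := hpos t
      have := Real.exp_pos (-2 * t)
      simp only [hf']; positivity
    rw [abs_of_pos hf'pos]
    have hx := hpos t
    set x := f t with hxdef
    have hx0 : (x : ℂ) ≠ 0 := by exact_mod_cast hx.ne'
    have h1x : (1 - (x : ℂ)) = ((Real.exp (-2 * t) * x : ℝ) : ℂ) := by
      rw [← hone t]; push_cast; rfl
    have hy : 0 < Real.exp (-2 * t) * x := by positivity
    have hy0 : ((Real.exp (-2 * t) * x : ℝ) : ℂ) ≠ 0 := by exact_mod_cast hy.ne'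
    simp only [hg]
    rw [h1x, Complex.cpow_def_of_ne_zero hx0, Complex.cpow_def_of_ne_zero hy0,
      ← Complex.ofReal_log hx.le, ← Complex.ofReal_log hy.le,
      Real.log_mul (Real.exp_pos _).ne' hx.ne', Real.log_exp, ← Complex.exp_add]
    have e1 : (Real.log x : ℂ) * (u - 1) + ((-2 * t + Real.log x : ℝ) : ℂ) * (v - 1)
        = ((-Real.log x + t : ℝ) : ℂ) + Complex.I * ω * t := by
      rw [hu, hv]; push_cast; ring
    rw [e1, Complex.exp_add, ← Complex.ofReal_exp, Complex.real_smul, ← mul_assoc,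
      ← Complex.ofReal_mul]
    congr 1
    rw [← Complex.ofReal_inv]
    congr 1
    rw [Real.exp_add, Real.exp_neg, Real.exp_log hx]
    simp only [hf', ← hxdef]
    have hxe : x = (1 + Real.exp (-2 * t))⁻¹ := rfl
    have e2 : Real.exp (-2 * t) = (Real.exp t)⁻¹ ^ 2 := by
      rw [← Real.exp_neg, ← Real.exp_nat_mul]; congr 1; push_cast; ring
    have hE := Real.exp_pos t
    rw [Real.cosh_eq, Real.exp_neg, hxe, e2]
    field_simp
  have hbeta := Complex.betaIntegral_convergent hure hvre
  have hIoo : IntegrableOn g (Set.Ioo 0 1) := by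
    rw [← integrableOn_Ioc_iff_integrableOn_Ioo]
    exact (intervalIntegrable_iff_integrableOn_Ioc_of_le zero_le_one).1 hbeta
  constructor
  · have := (integrableOn_image_iff_integrableOn_abs_deriv_smul MeasurableSet.univ hder hinj g).1
      (by rw [himg]; exact hIoo)
    rw [integrableOn_univ] at this
    simpa only [h_int] using this
  · have := integral_image_eq_integral_abs_deriv_smul MeasurableSet.univ hder hinj g
    rw [himg, setIntegral_univ] at this
    simp only [h_int] at this
    rw [← this, ← integral_Ioc_eq_integral_Ioo, ← intervalIntegral.integral_of_le zero_le_one]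
    change Complex.betaIntegral u v ≠ 0
    have h1 := Complex.Gamma_mul_Gamma_eq_betaIntegral hure hvre
    intro h0
    rw [h0, mul_zero] at h1
    exact (mul_ne_zero (Complex.Gamma_ne_zero_of_re_pos hure)
      (Complex.Gamma_ne_zero_of_re_pos hvre)) h1

theorem tendsto_hom₁ : Tendsto hom₁ atTop (𝓝 0) := by
  have h : Tendsto (fun t : ℝ => Real.exp (-t)) atTop (𝓝 0) :=
    Real.tendsto_exp_neg_atTop_nhds_zero
  have h2 : Tendsto (fun t : ℝ => Real.exp (-t) * (2 * Real.sqrt 2 / (1 + Real.exp (-t) ^ 2)))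
      atTop (𝓝 (0 * (2 * Real.sqrt 2 / (1 + 0 ^ 2)))) :=
    h.mul (tendsto_const_nhds.div (tendsto_const_nhds.add (h.pow 2)) (by norm_num))
  rw [zero_mul] at h2
  exact h2.congr fun t => (hom₁_eq_exp t).symm

/-- The Melnikov integral of the forcing term does not vanish. -/
theorem melnikov_ne_zero {ω M : ℝ} (hω : 0 < ω) (h : Tendsto (melSin ω) atTop (𝓝 M)) :
    M ≠ 0 := by
  obtain ⟨hi, hne⟩ := fourier_sech_integrable_and_ne_zero ω
  rintro rfl
  apply hne
  have hlim := intervalIntegral_tendsto_integral hi tendsto_neg_atTop_atBot tendsto_id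
  refine tendsto_nhds_unique hlim ?_
  set J : ℝ → ℂ := fun T => ∫ t in (-T)..T, ((Real.cosh t)⁻¹ : ℂ) * Complex.exp (Complex.I * ω * t)
  have hcont : Continuous fun t : ℝ => ((Real.cosh t)⁻¹ : ℂ) * Complex.exp (Complex.I * ω * t) := by
    have h1 : Continuous fun t : ℝ => ((Real.cosh t : ℝ) : ℂ)⁻¹ :=
      (Complex.continuous_ofReal.comp Real.continuous_cosh).inv₀ fun t => by
        exact Complex.ofReal_ne_zero.2 (Real.cosh_pos t).ne'
    exact h1.mul (by fun_prop)
  have hexp : ∀ t : ℝ, Complex.exp (Complex.I * ω * t)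
      = Real.cos (ω * t) + Complex.I * Real.sin (ω * t) := by
    intro t
    have : Complex.I * ω * t = ((ω * t : ℝ) : ℂ) * Complex.I := by push_cast; ring
    rw [this, Complex.exp_mul_I, Complex.ofReal_cos, Complex.ofReal_sin]; ring
  set r : ℝ := Real.sqrt 2 with hr
  have hr0 : r ≠ 0 := by rw [hr]; positivity
  set B : ℝ → ℂ := fun T => ((2 / (r * ω) * (hom₁ T * Real.sin (ω * T) - melSin ω T) : ℝ) : ℂ)
  have hJB : ∀ T, J T = B T := by
    intro T
    have hJd : ∀ T, HasDerivAt J ((2 * (Real.cosh T)⁻¹ * Real.cos (ω * T) : ℝ) : ℂ) T := by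
      intro T
      set k : ℝ → ℂ := fun t => ((Real.cosh t)⁻¹ : ℂ) * Complex.exp (Complex.I * ω * t) with hk
      have h1 : ∀ S, HasDerivAt (fun S => ∫ t in (0 : ℝ)..S, k t) (k S) S := fun S =>
        intervalIntegral.integral_hasDerivAt_right (hcont.intervalIntegrable _ _)
          (hcont.stronglyMeasurableAtFilter _ _) hcont.continuousAt
      have h2 := (h1 T).sub ((h1 (-T)).scomp T (hasDerivAt_neg T))
      have e : J = (fun S => ∫ t in (0 : ℝ)..S, k t) - (fun S => ∫ t in (0 : ℝ)..S, k t) ∘ Neg.neg := by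
        funext S
        exact (intervalIntegral.integral_interval_sub_left (hcont.intervalIntegrable _ _)
          (hcont.intervalIntegrable _ _)).symm
      rw [e]
      refine h2.congr_deriv ?_
      simp only [hk, hexp]
      simp only [Real.cosh_neg, mul_neg, Real.cos_neg, Real.sin_neg]
      push_cast
      simp
      ring
    have hBd : ∀ T, HasDerivAt B ((2 * (Real.cosh T)⁻¹ * Real.cos (ω * T) : ℝ) : ℂ) T := by
      intro T
      have hω' : HasDerivAt (fun t : ℝ => ω * t) ω T := by
        simpa using (hasDerivAt_id T).const_mul ω
      have h1 := (((hasDerivAt_hom₁ T).mul hω'.sin).sub (hasDerivAt_melSin ω T)).const_mul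
        (2 / (r * ω))
      refine (h1.congr_deriv ?_).ofReal_comp
      have : hom₁ T = r * (Real.cosh T)⁻¹ := rfl
      rw [this]
      field_simp
      ring
    have hd : ∀ r, HasDerivAt (fun T => J T - B T) 0 r := fun T =>
      ((hJd T).sub (hBd T)).congr_deriv (sub_self _)
    have := is_const_of_deriv_eq_zero (fun r => (hd r).differentiableAt) (fun r => (hd r).deriv) T 0
    have h0 : J 0 = 0 := by simp [J]
    have h0' : B 0 = 0 := by simp [B, melSin]
    simp only [h0, h0', sub_self] at this
    exact sub_eq_zero.1 this
  have hBlim : Tendsto B atTop (𝓝 ((2 / (r * ω) * (0 - 0) : ℝ) : ℂ)) := by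
    refine (Complex.continuous_ofReal.tendsto _).comp (Tendsto.const_mul _ (Tendsto.sub ?_ h))
    refine squeeze_zero_norm (fun t => ?_) tendsto_hom₁
    rw [norm_mul, Real.norm_eq_abs, Real.norm_eq_abs, abs_of_pos (hom₁_pos t)]
    exact mul_le_of_le_one_right (hom₁_pos t).le (Real.abs_sin_le_one _)
  have : Tendsto J atTop (𝓝 0) := by
    rw [show J = B from funext hJB]
    simpa using hBlim
  exact this

/-- A periodic function of `t` that equals `exp (N t)` times an analytic function of
`exp (-t)` is constant. -/
theorem periodic_eq_of_analytic_exp {Y C : ℝ → ℝ} {τ T : ℝ} {N : ℕ} (hY : AnalyticAt ℝ Y 0)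
    (hτ : 0 < τ) (hC : Function.Periodic C τ)
    (h : ∀ t, T < t → Real.exp (-t) ^ N * C t = Y (Real.exp (-t))) (a b : ℝ) : C a = C b := by
  have hs : ∀ t, Tendsto (fun j : ℕ => Real.exp (-(t + j * τ))) atTop (𝓝 0) := by
    intro t
    have h1 : Tendsto (fun j : ℕ => t + (j : ℝ) * τ) atTop atTop :=
      tendsto_atTop_add_const_left _ _
        (tendsto_natCast_atTop_atTop.atTop_mul_const hτ)
    exact Real.tendsto_exp_neg_atTop_nhds_zero.comp h1
  have hev : ∀ t, ∀ᶠ j : ℕ in atTop, Real.exp (-(t + j * τ)) ^ N * C t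
      = Y (Real.exp (-(t + j * τ))) := by
    intro t
    have h1 : Tendsto (fun j : ℕ => t + (j : ℝ) * τ) atTop atTop :=
      tendsto_atTop_add_const_left _ _
        (tendsto_natCast_atTop_atTop.atTop_mul_const hτ)
    filter_upwards [h1.eventually_gt_atTop T] with j hj
    rw [← h _ hj, hC.nat_mul j]
  by_cases hz : ∀ᶠ s in 𝓝 (0 : ℝ), Y s = 0
  · have : ∀ t, C t = 0 := by
      intro t
      obtain ⟨j, hj1, hj2⟩ := ((hev t).and ((hs t).eventually hz)).exists
      rw [hj2] at hj1
      exact (mul_eq_zero.1 hj1).resolve_left (by positivity)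
    rw [this, this]
  obtain ⟨k, u, hu, hu0, hYu⟩ := hY.exists_eventuallyEq_pow_smul_nonzero_iff.2 hz
  have key : ∀ t, ∀ᶠ j : ℕ in atTop, Real.exp (-(t + j * τ)) ^ N * C t
      = Real.exp (-(t + j * τ)) ^ k * u (Real.exp (-(t + j * τ))) := by
    intro t
    filter_upwards [hev t, (hs t).eventually hYu] with j h1 h2
    rw [h1, h2]; simp
  have hulim : ∀ t, Tendsto (fun j : ℕ => u (Real.exp (-(t + j * τ)))) atTop (𝓝 (u 0)) :=
    fun t => hu.continuousAt.tendsto.comp (hs t)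
  rcases lt_trichotomy k N with hk | hk | hk
  · exfalso
    apply hu0
    obtain ⟨d, rfl⟩ := Nat.exists_eq_add_of_lt hk
    have h1 : Tendsto (fun j : ℕ => Real.exp (-(0 + j * τ)) ^ (d + 1) * C 0) atTop
        (𝓝 (0 ^ (d + 1) * C 0)) := ((hs 0).pow _).mul_const _
    rw [zero_pow (by omega), zero_mul] at h1
    refine tendsto_nhds_unique ((hulim 0).congr' ?_) h1
    filter_upwards [key 0] with j hj
    have he : Real.exp (-(0 + j * τ)) ^ k ≠ 0 := by positivity
    apply mul_left_cancel₀ he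
    rw [← hj]; ring
  · subst hk
    have : ∀ t, C t = u 0 := by
      intro t
      refine tendsto_nhds_unique (tendsto_const_nhds.congr' ?_) (hulim t)
      filter_upwards [key t] with j hj
      have he : Real.exp (-(t + j * τ)) ^ k ≠ 0 := by positivity
      exact mul_left_cancel₀ he hj
    rw [this, this]
  · obtain ⟨d, rfl⟩ := Nat.exists_eq_add_of_lt hk
    have : ∀ t, C t = 0 := by
      intro t
      have h1 : Tendsto (fun j : ℕ => Real.exp (-(t + j * τ)) ^ (d + 1)
          * u (Real.exp (-(t + j * τ)))) atTop (𝓝 (0 ^ (d + 1) * u 0)) :=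
        ((hs t).pow _).mul (hulim t)
      rw [zero_pow (by omega), zero_mul] at h1
      refine tendsto_nhds_unique (tendsto_const_nhds.congr' ?_) h1
      filter_upwards [key t] with j hj
      have he : Real.exp (-(t + j * τ)) ^ N ≠ 0 := by positivity
      apply mul_left_cancel₀ he
      rw [hj]; ring
    rw [this, this]

/-- Limit of the normal amplitude at the end `sg = ±1`, given the limits `Mc`, `Ms` of the
Melnikov integrals. -/
noncomputable def endAmp (β δ Mc Ms sg b e p q : ℝ) : ℝ :=
  b + β * (p * Mc - sg * q * Ms) - sg * (δ * e * (2 / 3))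

/-- A quantity attached to the solutions of the variational equation that is analytic in
`exp (-|t|)` up to a power at both ends depends only on `e` and `p ^ 2 + q ^ 2`. -/
theorem eq_of_analytic_ends {β δ ω Mc Ms : ℝ} (hβ : 0 < β) (hω : 0 < ω) (hMs : Ms ≠ 0)
    {K : ℝ → ℝ → ℝ → ℝ → ℝ} {N : ℕ} {T : ℝ}
    (hK : ∀ sg : ℝ, sg = 1 ∨ sg = -1 → ∀ B e vr vi : ℝ, ∃ Y : ℝ → ℝ, AnalyticAt ℝ Y 0 ∧
      ∀ t, T < t → ∀ b p q, rotRe ω p q (sg * t) = vr → rotIm ω p q (sg * t) = vi →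
        endAmp β δ Mc Ms sg b e p q = B → Real.exp (-t) ^ N * K b e p q = Y (Real.exp (-t)))
    {b e p q b' p' q' : ℝ} (hpq : p ^ 2 + q ^ 2 = p' ^ 2 + q' ^ 2) (hpos : 0 < p ^ 2 + q ^ 2) :
    K b e p q = K b' e p' q' := by
  have hrot : ∀ sg : ℝ, sg = 1 ∨ sg = -1 → ∀ b p q b' p' q' : ℝ,
      p ^ 2 + q ^ 2 = p' ^ 2 + q' ^ 2 → 0 < p ^ 2 + q ^ 2 →
      endAmp β δ Mc Ms sg b e p q = endAmp β δ Mc Ms sg b' e p' q' →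
      K b e p q = K b' e p' q' := by
    intro sg hsg b p q b' p' q' hpq hpos hend
    have hsg2 : sg * sg = 1 := by rcases hsg with rfl | rfl <;> norm_num
    obtain ⟨Y, hY, hYK⟩ := hK sg hsg (endAmp β δ Mc Ms sg b e p q) e p q
    set P : ℝ → ℝ := fun t => p * Real.cos (ω * (sg * t)) + q * Real.sin (ω * (sg * t)) with hP
    set Q : ℝ → ℝ := fun t => q * Real.cos (ω * (sg * t)) - p * Real.sin (ω * (sg * t)) with hQ
    set Bt : ℝ → ℝ := fun t => endAmp β δ Mc Ms sg b e p q - β * (P t * Mc - sg * Q t * Ms)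
      + sg * (δ * e * (2 / 3)) with hBt
    have hconst := periodic_eq_of_analytic_exp (Y := Y) (C := fun t => K (Bt t) e (P t) (Q t))
      (τ := 2 * Real.pi / ω) (T := T) (N := N) hY (by positivity) (by
        intro t
        have hper : P (t + 2 * Real.pi / ω) = P t ∧ Q (t + 2 * Real.pi / ω) = Q t := by
          have e1 : ω * (sg * (t + 2 * Real.pi / ω)) = ω * (sg * t) + sg * (2 * Real.pi) := by
            field_simp
          simp only [hP, hQ, e1]
          rcases hsg with rfl | rfl
          · simp
          · simp only [neg_one_mul, ← sub_eq_add_neg, Real.cos_sub_two_pi, Real.sin_sub_two_pi,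
              true_and]
        simp only [hBt, hper.1, hper.2])
      (by
        intro t ht
        have hcs := Real.cos_sq_add_sin_sq (ω * (sg * t))
        refine hYK t ht _ _ _ ?_ ?_ ?_
        · simp only [rotRe, hP, hQ]; linear_combination p * hcs
        · simp only [rotIm, hP, hQ]; linear_combination q * hcs
        · simp only [hBt, endAmp]; ring)
    have hfin : ∀ θ, P θ = p' → Q θ = q' → K b e p q = K b' e p' q' := by
      intro θ h1 h2
      have h3 := hconst 0 θ
      have h4 : P 0 = p := by simp [hP]
      have h5 : Q 0 = q := by simp [hQ]
      have h6 : Bt 0 = b := by simp only [hBt, endAmp, h4, h5]; ring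
      have h7 : Bt θ = b' := by
        simp only [hBt, h1, h2, hend]; simp only [endAmp]; ring
      simpa only [h1, h2, h4, h5, h6, h7] using h3
    set R : ℝ := p ^ 2 + q ^ 2 with hR
    set c : ℝ := (p * p' + q * q') / R with hc
    set d : ℝ := (q * p' - p * q') / R with hd
    have hcd : c ^ 2 + d ^ 2 = 1 := by
      rw [hc, hd]
      field_simp
      have : R ^ 2 = (p ^ 2 + q ^ 2) * (p' ^ 2 + q' ^ 2) := by rw [← hpq, ← hR]; ring
      rw [this]; ring
    set z : ℂ := ⟨c, d⟩ with hz
    have hnz : ‖z‖ = 1 := by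
      have : ‖z‖ ^ 2 = 1 := by rw [← Complex.normSq_eq_norm_sq, Complex.normSq_mk, ← hcd]; ring
      nlinarith [norm_nonneg z]
    have hz0 : z ≠ 0 := by intro h; rw [h, norm_zero] at hnz; norm_num at hnz
    have hcos : Real.cos z.arg = c := by rw [Complex.cos_arg hz0, hnz, div_one]
    have hsin : Real.sin z.arg = d := by rw [Complex.sin_arg, hnz, div_one]
    have harg : ω * (sg * (sg * z.arg / ω)) = z.arg := by
      field_simp; linear_combination z.arg * hsg2
    apply hfin (sg * z.arg / ω)
    · simp only [hP, harg, hcos, hsin, hc, hd]; field_simp; rw [hR]; ring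
    · simp only [hQ, harg, hcos, hsin, hc, hd]; field_simp; rw [hR]; ring
  set R : ℝ := Real.sqrt (p ^ 2 + q ^ 2) with hR
  have hRpos : 0 < R := Real.sqrt_pos.2 hpos
  have hR2 : R ^ 2 = p ^ 2 + q ^ 2 := Real.sq_sqrt hpos.le
  set Φ : ℝ → ℝ := fun y => K y e R 0 with hΦ
  have hKΦ : ∀ b p q, p ^ 2 + q ^ 2 = R ^ 2 → K b e p q = Φ (b + β * (p * Mc + q * Ms) - β * R * Mc) := by
    intro b p q h
    refine hrot (-1) (Or.inr rfl) _ _ _ _ _ _ (by rw [h]; ring) (by rw [h]; positivity) ?_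
    simp only [endAmp]; ring
  have hshift : ∀ y q, q ^ 2 ≤ R ^ 2 → Φ (y + 2 * β * q * Ms) = Φ y := by
    intro y q hq
    set p : ℝ := Real.sqrt (R ^ 2 - q ^ 2) with hp
    have hp2 : p ^ 2 = R ^ 2 - q ^ 2 := Real.sq_sqrt (by linarith)
    have h1 := hKΦ (y + β * R * Mc - β * (p * Mc - q * Ms)) p q (by rw [hp2]; ring)
    have h2 : K (y + β * R * Mc - β * (p * Mc - q * Ms)) e p q = K y e R 0 := by
      refine hrot 1 (Or.inl rfl) _ _ _ _ _ _ (by rw [hp2]; ring) (by rw [hp2]; nlinarith) ?_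
      simp only [endAmp]; ring
    rw [h2] at h1
    rw [hΦ]
    simp only
    rw [h1]
    simp only [hΦ]
    congr 1
    ring
  have hloc : IsLocallyConstant Φ := by
    rw [IsLocallyConstant.iff_eventually_eq]
    intro x
    set r : ℝ := R * (2 * β * |Ms|) with hr
    have hMs' : 0 < |Ms| := abs_pos.2 hMs
    have hrpos : 0 < r := by positivity
    filter_upwards [Metric.ball_mem_nhds x hrpos] with y hy
    rw [Metric.mem_ball, Real.dist_eq] at hy
    have := hshift x ((y - x) / (2 * β * Ms)) (by
      rw [sq_le_sq, abs_div, abs_of_pos hRpos, abs_mul, abs_of_pos (by positivity : 0 < 2 * β),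
        div_le_iff₀ (by positivity)]
      exact hy.le)
    rw [← this]
    congr 1
    field_simp
    ring
  rw [hKΦ b p q hR2.symm, hKΦ b' p' q' (by rw [hR2, hpq])]
  exact hloc.apply_eq_of_preconnectedSpace _ _

/-- `hom₁ t / exp (-t)` as a function of `exp (-t)`. -/
noncomputable def endCoef₁ (s : ℝ) : ℝ := 2 * Real.sqrt 2 / (1 + s ^ 2)

/-- `hom₂ t / exp (-t)` as a function of `exp (-t)`. -/
noncomputable def endCoef₂ (s : ℝ) : ℝ := -(endCoef₁ s * ((1 - s ^ 2) / (1 + s ^ 2)))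

/-- `hom₃ t / exp (-t)` as a function of `exp (-t)`. -/
noncomputable def endCoef₃ (s : ℝ) : ℝ := endCoef₁ s - s ^ 2 * endCoef₁ s ^ 3

/-- The homoclinic orbit near the end `sg = ±1` as a function of `exp (-|t|)`. -/
noncomputable def endOrbit (sg s : ℝ) : Fin 5 → ℝ :=
  ![s * endCoef₁ s, sg * (s * endCoef₂ s), 0, 0, 0]

theorem analyticAt_endCoef₁ (s : ℝ) : AnalyticAt ℝ endCoef₁ s :=
  analyticAt_const.div (analyticAt_const.add (analyticAt_id.pow 2)) (by
    change (1 : ℝ) + s ^ 2 ≠ 0; positivity)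

theorem analyticAt_endCoef₂ (s : ℝ) : AnalyticAt ℝ endCoef₂ s :=
  ((analyticAt_endCoef₁ s).mul ((analyticAt_const.sub (analyticAt_id.pow 2)).div
    (analyticAt_const.add (analyticAt_id.pow 2)) (by
      change (1 : ℝ) + s ^ 2 ≠ 0; positivity))).neg

theorem analyticAt_endCoef₃ (s : ℝ) : AnalyticAt ℝ endCoef₃ s :=
  (analyticAt_endCoef₁ s).sub ((analyticAt_id.pow 2).mul ((analyticAt_endCoef₁ s).pow 3))

theorem tanh_eq_exp (t : ℝ) :
    Real.tanh t = (1 - Real.exp (-t) ^ 2) / (1 + Real.exp (-t) ^ 2) := by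
  have h : Real.exp t = (Real.exp (-t))⁻¹ := by rw [Real.exp_neg, inv_inv]
  have := Real.exp_pos (-t)
  rw [Real.tanh_eq_sinh_div_cosh, Real.sinh_eq, Real.cosh_eq, h]
  field_simp

theorem hom₁_end {sg : ℝ} (hsg : sg = 1 ∨ sg = -1) (t : ℝ) :
    hom₁ (sg * t) = Real.exp (-t) * endCoef₁ (Real.exp (-t)) := by
  rcases hsg with rfl | rfl
  · rw [one_mul, hom₁_eq_exp, endCoef₁]
  · rw [neg_one_mul, hom₁_neg, hom₁_eq_exp, endCoef₁]

theorem hom₂_end {sg : ℝ} (hsg : sg = 1 ∨ sg = -1) (t : ℝ) :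
    hom₂ (sg * t) = sg * (Real.exp (-t) * endCoef₂ (Real.exp (-t))) := by
  have h : hom₂ t = Real.exp (-t) * endCoef₂ (Real.exp (-t)) := by
    have e1 : hom₂ t = -(hom₁ t * Real.tanh t) := rfl
    rw [e1, hom₁_eq_exp, tanh_eq_exp, endCoef₂, endCoef₁]; ring
  rcases hsg with rfl | rfl
  · rw [one_mul, h, one_mul]
  · rw [neg_one_mul, hom₂_neg, h]; ring

theorem hom₃_end {sg : ℝ} (hsg : sg = 1 ∨ sg = -1) (t : ℝ) :
    hom₃ (sg * t) = Real.exp (-t) * endCoef₃ (Real.exp (-t)) := by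
  rw [hom₃, hom₁_end hsg, endCoef₃]; ring

theorem homOrbit_end {sg : ℝ} (hsg : sg = 1 ∨ sg = -1) (t : ℝ) :
    homOrbit (sg * t) = endOrbit sg (Real.exp (-t)) := by
  rw [homOrbit, endOrbit, hom₁_end hsg, hom₂_end hsg]

theorem endOrbit_zero (sg : ℝ) : endOrbit sg 0 = 0 := by
  funext i; fin_cases i <;> simp [endOrbit]

theorem analyticAt_endOrbit (sg s : ℝ) : AnalyticAt ℝ (endOrbit sg) s := by
  rw [analyticAt_pi_iff]
  intro i
  fin_cases i
  · exact analyticAt_id.mul (analyticAt_endCoef₁ s)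
  · exact analyticAt_const.mul (analyticAt_id.mul (analyticAt_endCoef₂ s))
  all_goals exact analyticAt_const

theorem homSpeedSq_end {sg : ℝ} (hsg : sg = 1 ∨ sg = -1) (t : ℝ) :
    homSpeedSq (sg * t) = Real.exp (-t) ^ 2 *
      (endCoef₂ (Real.exp (-t)) ^ 2 + endCoef₃ (Real.exp (-t)) ^ 2) := by
  have hsg2 : sg * sg = 1 := by rcases hsg with rfl | rfl <;> norm_num
  rw [homSpeedSq, hom₂_end hsg, hom₃_end hsg]
  linear_combination (Real.exp (-t) ^ 2 * endCoef₂ (Real.exp (-t)) ^ 2) * hsg2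

/-- Expansions of the solutions of the variational equation at both ends of the homoclinic
orbit. -/
theorem exists_end_expansion (β δ : ℝ) {ω : ℝ} (hω : 0 < ω) : ∃ Mc Ms : ℝ, Ms ≠ 0 ∧
    Tendsto (melCos ω) atTop (𝓝 Mc) ∧ Tendsto (melSin ω) atTop (𝓝 Ms) ∧
    ∀ sg : ℝ, sg = 1 ∨ sg = -1 → ∀ e vr vi : ℝ, ∃ Ξ₀ Ξ₁ : ℝ → Fin 5 → ℝ,
      (∀ i, AnalyticAt ℝ (fun s => Ξ₀ s i) 0) ∧ (∀ i, AnalyticAt ℝ (fun s => Ξ₁ s i) 0) ∧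
      ∀ t, Real.log 2 < t → ∀ b p q, rotRe ω p q (sg * t) = vr → rotIm ω p q (sg * t) = vi →
        Real.exp (-t) • varSol β δ ω b e p q (sg * t)
          = endAmp β δ Mc Ms sg b e p q • Ξ₀ (Real.exp (-t))
            + Real.exp (-t) • Ξ₁ (Real.exp (-t)) := by
  obtain ⟨gr, gi, Mc, Ms, hgr, hgi, hmel⟩ := exists_melnikov_asymptotics hω
  have hs0 : Tendsto (fun t : ℝ => Real.exp (-t)) atTop (𝓝 0) :=
    Real.tendsto_exp_neg_atTop_nhds_zero
  have hbdd : ∀ {k : ℝ → ℝ} {g : ℝ → ℝ}, (∀ t, |k t| ≤ 1) → AnalyticAt ℝ g 0 →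
      Tendsto (fun t => Real.exp (-t) * (k t * g (Real.exp (-t)))) atTop (𝓝 0) := by
    intro k g hk hg
    have h1 : Tendsto (fun t => |Real.exp (-t) * g (Real.exp (-t))|) atTop (𝓝 |0 * g 0|) :=
      (hs0.mul (hg.continuousAt.tendsto.comp hs0)).abs
    rw [zero_mul, abs_zero] at h1
    refine squeeze_zero_norm (fun t => ?_) h1
    rw [Real.norm_eq_abs, abs_mul, abs_mul, abs_mul]
    have := mul_le_mul_of_nonneg_right (hk t) (abs_nonneg (g (Real.exp (-t))))
    rw [one_mul] at this
    exact mul_le_mul_of_nonneg_left this (abs_nonneg _)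
  have hcosb : ∀ t, |Real.cos (ω * t)| ≤ 1 := fun t => Real.abs_cos_le_one _
  have hsinb : ∀ t, |Real.sin (ω * t)| ≤ 1 := fun t => Real.abs_sin_le_one _
  have hMc : Tendsto (melCos ω) atTop (𝓝 Mc) := by
    have h1 := ((hbdd hcosb hgr).sub (hbdd hsinb hgi)).const_add Mc
    rw [sub_zero, add_zero] at h1
    refine h1.congr' ?_
    filter_upwards [eventually_gt_atTop (Real.log 2)] with t ht
    rw [(hmel t ht).1]; ring
  have hMs : Tendsto (melSin ω) atTop (𝓝 Ms) := by
    have h1 := ((hbdd hcosb hgi).add (hbdd hsinb hgr)).const_add Ms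
    rw [add_zero, add_zero] at h1
    refine h1.congr' ?_
    filter_upwards [eventually_gt_atTop (Real.log 2)] with t ht
    rw [(hmel t ht).2]; ring
  refine ⟨Mc, Ms, melnikov_ne_zero hω hMs, hMc, hMs, fun sg hsg e vr vi => ?_⟩
  set J : ℝ → ℝ := fun s => 2 / 3 * (-(2 * s) / (1 + s ^ 2)) *
    (((1 - s ^ 2) / (1 + s ^ 2)) ^ 2 + (1 - s ^ 2) / (1 + s ^ 2) + 1) with hJ
  set A : ℝ → ℝ := fun s => β * (vr * gr s - sg * vi * gi s) - sg * (δ * e) * J s with hA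
  set n₁ : ℝ → ℝ := fun s => -endCoef₃ s / (endCoef₂ s ^ 2 + endCoef₃ s ^ 2) with hn₁
  set n₂ : ℝ → ℝ := fun s => sg * endCoef₂ s / (endCoef₂ s ^ 2 + endCoef₃ s ^ 2) with hn₂
  have hJan : AnalyticAt ℝ J 0 := by
    have hid : AnalyticAt ℝ (fun s : ℝ => s) 0 := analyticAt_id
    have hden : AnalyticAt ℝ (fun s : ℝ => 1 + s ^ 2) 0 := analyticAt_const.add (hid.pow 2)
    have hT : AnalyticAt ℝ (fun s : ℝ => (1 - s ^ 2) / (1 + s ^ 2)) 0 :=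
      (analyticAt_const.sub (hid.pow 2)).div hden (by norm_num)
    exact (analyticAt_const.mul ((analyticAt_const.mul hid).neg.div hden (by norm_num))).mul
      (((hT.pow 2).add hT).add analyticAt_const)
  have hAan : AnalyticAt ℝ A 0 :=
    (analyticAt_const.mul ((analyticAt_const.mul hgr).sub (analyticAt_const.mul hgi))).sub
      (analyticAt_const.mul hJan)
  have hN : AnalyticAt ℝ (fun s => endCoef₂ s ^ 2 + endCoef₃ s ^ 2) 0 :=
    ((analyticAt_endCoef₂ 0).pow 2).add ((analyticAt_endCoef₃ 0).pow 2)
  have hN0 : endCoef₂ 0 ^ 2 + endCoef₃ 0 ^ 2 ≠ 0 := by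
    simp [endCoef₂, endCoef₃, endCoef₁]
  have hn₁an : AnalyticAt ℝ n₁ 0 := (analyticAt_endCoef₃ 0).neg.div hN hN0
  have hn₂an : AnalyticAt ℝ n₂ 0 := (analyticAt_const.mul (analyticAt_endCoef₂ 0)).div hN hN0
  refine ⟨fun s => ![n₁ s, n₂ s, 0, 0, 0], fun s => ![A s * n₁ s, A s * n₂ s, e, vr, vi],
    fun i => ?_, fun i => ?_, fun t ht b p q hvr hvi => ?_⟩
  · fin_cases i
    · exact hn₁an
    · exact hn₂an
    all_goals exact analyticAt_const
  · fin_cases i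
    · exact hAan.mul hn₁an
    · exact hAan.mul hn₂an
    all_goals exact analyticAt_const
  set s : ℝ := Real.exp (-t) with hs
  have hspos : 0 < s := Real.exp_pos _
  have hΔ : homSpeedSq (sg * t) = s ^ 2 * (endCoef₂ s ^ 2 + endCoef₃ s ^ 2) := homSpeedSq_end hsg t
  have hNs : endCoef₂ s ^ 2 + endCoef₃ s ^ 2 ≠ 0 := by
    intro h
    have := homSpeedSq_pos (sg * t)
    rw [hΔ, h, mul_zero] at this
    exact lt_irrefl _ this
  have htanh : 2 / 3 * Real.tanh (sg * t) ^ 3 = sg * (2 / 3 + s * J s) := by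
    have h1 : 2 / 3 * Real.tanh t ^ 3 = 2 / 3 + s * J s := by
      rw [tanh_eq_exp, ← hs, hJ]
      field_simp
      ring
    rcases hsg with rfl | rfl
    · rw [one_mul, h1]; ring
    · rw [neg_one_mul, Real.tanh_neg, ← h1]; ring
  have hamp : varAmp β δ ω b e p q (sg * t) = endAmp β δ Mc Ms sg b e p q + s * A s := by
    obtain ⟨h1, h2⟩ := hmel t ht
    rw [← hs] at h1 h2
    rw [varAmp, endAmp, htanh, hA]
    simp only [← hvr, ← hvi, rotRe, rotIm]
    rcases hsg with rfl | rfl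
    · rw [one_mul, h1, h2]; ring
    · rw [neg_one_mul, melCos_neg, melSin_neg, h1, h2, mul_neg ω t, Real.cos_neg, Real.sin_neg]; ring
  have hv1 : s * (-hom₃ (sg * t) / homSpeedSq (sg * t)) = n₁ s := by
    rw [hom₃_end hsg, hΔ, ← hs, hn₁]; field_simp
  have hv2 : s * (hom₂ (sg * t) / homSpeedSq (sg * t)) = n₂ s := by
    rw [hom₂_end hsg, hΔ, ← hs, hn₂]; field_simp
  funext i
  fin_cases i
  · simp [varSol, hamp, ← hv1]; ring
  · simp [varSol, hamp, ← hv2]; ring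
  · simp [varSol]
  · simp [varSol, hvr]
  · simp [varSol, hvi]

section
variable {U : Set (Fin 5 → ℝ)}

theorem jet_mul_leading (hU : IsOpen U) (m : ℕ) {φ ψ : (Fin 5 → ℝ) → ℝ}
    (hφ : AnalyticOnNhd ℝ φ U) (hψ : AnalyticOnNhd ℝ ψ U) {x : Fin 5 → ℝ} (hx : x ∈ U)
    (ξ : Fin 5 → ℝ) (h0 : ∀ i < m, jet i ψ x ξ = 0) :
    jet m (fun y => φ y * ψ y) x ξ = φ x * jet m ψ x ξ := by
  rw [jet_mul_of_vanish hU m hφ hψ hx ξ fun i hi => h0 i (by omega)]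
  rcases m with _ | m
  · simp
  · rw [Nat.add_sub_cancel, h0 m (by omega)]; simp

theorem lieDeriv_add (f : (Fin 5 → ℝ) → Fin 5 → ℝ) {φ ψ : (Fin 5 → ℝ) → ℝ} {x : Fin 5 → ℝ}
    (hφ : AnalyticAt ℝ φ x) (hψ : AnalyticAt ℝ ψ x) :
    lieDeriv f (fun y => φ y + ψ y) x = lieDeriv f φ x + lieDeriv f ψ x := by
  rw [lieDeriv_eq_fderiv, lieDeriv_eq_fderiv, lieDeriv_eq_fderiv,
    fderiv_fun_add hφ.differentiableAt hψ.differentiableAt]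
  rfl

theorem lieDeriv_sub (f : (Fin 5 → ℝ) → Fin 5 → ℝ) {φ ψ : (Fin 5 → ℝ) → ℝ} {x : Fin 5 → ℝ}
    (hφ : AnalyticAt ℝ φ x) (hψ : AnalyticAt ℝ ψ x) :
    lieDeriv f (fun y => φ y - ψ y) x = lieDeriv f φ x - lieDeriv f ψ x := by
  rw [lieDeriv_eq_fderiv, lieDeriv_eq_fderiv, lieDeriv_eq_fderiv,
    fderiv_fun_sub hφ.differentiableAt hψ.differentiableAt]
  rfl

theorem lieDeriv_neg (f : (Fin 5 → ℝ) → Fin 5 → ℝ) (φ : (Fin 5 → ℝ) → ℝ) (x : Fin 5 → ℝ) :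
    lieDeriv f (fun y => -φ y) x = -lieDeriv f φ x := by
  rw [lieDeriv_eq_fderiv, lieDeriv_eq_fderiv, fderiv_fun_neg]
  rfl

theorem lieDeriv_mul (f : (Fin 5 → ℝ) → Fin 5 → ℝ) {φ ψ : (Fin 5 → ℝ) → ℝ} {x : Fin 5 → ℝ}
    (hφ : AnalyticAt ℝ φ x) (hψ : AnalyticAt ℝ ψ x) :
    lieDeriv f (fun y => φ y * ψ y) x = lieDeriv f φ x * ψ x + φ x * lieDeriv f ψ x := by
  rw [lieDeriv_eq_fderiv, lieDeriv_eq_fderiv, lieDeriv_eq_fderiv,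
    fderiv_fun_mul hφ.differentiableAt hψ.differentiableAt]
  simp
  ring

theorem analyticOnNhd_coord (k : Fin 5) (U : Set (Fin 5 → ℝ)) :
    AnalyticOnNhd ℝ (fun y : Fin 5 → ℝ => y k) U := fun x _ =>
  (ContinuousLinearMap.proj (R := ℝ) (φ := fun _ : Fin 5 => ℝ) k).analyticAt x

theorem fderiv_coord (k : Fin 5) (x ξ : Fin 5 → ℝ) :
    fderiv ℝ (fun y : Fin 5 → ℝ => y k) x ξ = ξ k := by
  have h : HasFDerivAt (fun y : Fin 5 → ℝ => y k)
      (ContinuousLinearMap.proj (R := ℝ) (φ := fun _ : Fin 5 => ℝ) k) x :=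
    (ContinuousLinearMap.proj (R := ℝ) (φ := fun _ : Fin 5 => ℝ) k).hasFDerivAt
  rw [h.fderiv]; rfl

theorem lieDeriv_coord (f : (Fin 5 → ℝ) → Fin 5 → ℝ) (k : Fin 5) (x : Fin 5 → ℝ) :
    lieDeriv f (fun y => y k) x = f x k := by
  rw [lieDeriv_eq_fderiv, fderiv_coord]

theorem analyticOnNhd_jet_direction (j : ℕ) {φ : (Fin 5 → ℝ) → ℝ}
    (h : AnalyticOnNhd ℝ φ U) {x : Fin 5 → ℝ} (hx : x ∈ U) :
    AnalyticOnNhd ℝ (fun ξ => jet j φ x ξ) Set.univ := fun ξ _ =>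
  analyticAt_jet (X := fun _ => x) (Ξ := fun ξ => ξ) j h analyticAt_const hx
    fun i => analyticOnNhd_coord i Set.univ ξ trivial

/-- A linear combination of jets that vanishes for directions near one direction vanishes. -/
theorem jet_comb_eq_zero_of_eventually (j : ℕ) {φ ψ : (Fin 5 → ℝ) → ℝ}
    (hφ : AnalyticOnNhd ℝ φ U) (hψ : AnalyticOnNhd ℝ ψ U) {x : Fin 5 → ℝ} (hx : x ∈ U) (a b : ℝ)
    {ξ₀ : Fin 5 → ℝ} (h : ∀ᶠ ξ in 𝓝 ξ₀, a * jet j φ x ξ + b * jet j ψ x ξ = 0)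
    (ξ : Fin 5 → ℝ) : a * jet j φ x ξ + b * jet j ψ x ξ = 0 := by
  have han : AnalyticOnNhd ℝ (fun ξ => a * jet j φ x ξ + b * jet j ψ x ξ) Set.univ :=
    (analyticOnNhd_const.mul (analyticOnNhd_jet_direction j hφ hx)).add
      (analyticOnNhd_const.mul (analyticOnNhd_jet_direction j hψ hx))
  have := han.eqOn_zero_of_preconnected_of_eventuallyEq_zero isPreconnected_univ
    (Set.mem_univ ξ₀) h
  exact this (Set.mem_univ ξ)

end

theorem tendsto_exp_neg_period {ω : ℝ} (hω : 0 < ω) :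
    Tendsto (fun j : ℕ => Real.exp (-(j * (2 * Real.pi / ω)))) atTop (𝓝 0) :=
  Real.tendsto_exp_neg_atTop_nhds_zero.comp
    (tendsto_natCast_atTop_atTop.atTop_mul_const (by positivity))

theorem rot_period {ω : ℝ} (hω : 0 < ω) (p q : ℝ) {sg : ℝ} (hsg : sg = 1 ∨ sg = -1) (j : ℕ) :
    rotRe ω p q (sg * (j * (2 * Real.pi / ω))) = p ∧
      rotIm ω p q (sg * (j * (2 * Real.pi / ω))) = q := by
  have hc : ω * (j * (2 * Real.pi / ω)) = j * (2 * Real.pi) := by field_simp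
  have h1 : Real.cos (ω * (j * (2 * Real.pi / ω))) = 1 := by
    rw [hc, Real.cos_nat_mul_two_pi]
  have h2 : Real.sin (ω * (j * (2 * Real.pi / ω))) = 0 := by
    rw [hc]
    have := Real.sin_nat_mul_pi (2 * j)
    rw [← this]; congr 1; push_cast; ring
  rcases hsg with rfl | rfl
  · simp only [rotRe, rotIm, one_mul, h1, h2]; constructor <;> ring
  · simp only [rotRe, rotIm, neg_one_mul, mul_neg ω, Real.cos_neg, Real.sin_neg, h1, h2]
    constructor <;> ring

/-- Solutions of the variational equation, expanded at both ends of the homoclinic orbit. -/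
def EndExpansion (β δ ω Mc Ms : ℝ) : Prop :=
  ∀ sg : ℝ, sg = 1 ∨ sg = -1 → ∀ e vr vi : ℝ, ∃ Ξ₀ Ξ₁ : ℝ → Fin 5 → ℝ,
    (∀ i, AnalyticAt ℝ (fun s => Ξ₀ s i) 0) ∧ (∀ i, AnalyticAt ℝ (fun s => Ξ₁ s i) 0) ∧
    ∀ t, Real.log 2 < t → ∀ b p q, rotRe ω p q (sg * t) = vr → rotIm ω p q (sg * t) = vi →
      Real.exp (-t) • varSol β δ ω b e p q (sg * t)
        = endAmp β δ Mc Ms sg b e p q • Ξ₀ (Real.exp (-t))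
          + Real.exp (-t) • Ξ₁ (Real.exp (-t))

section
variable {β δ ω Mc Ms : ℝ} {U : Set (Fin 5 → ℝ)}

theorem EndExpansion.exists_analytic_jet (hexp : EndExpansion β δ ω Mc Ms)
    (h0U : (0 : Fin 5 → ℝ) ∈ U) {φ : (Fin 5 → ℝ) → ℝ} (hφ : AnalyticOnNhd ℝ φ U) (m : ℕ)
    {sg : ℝ} (hsg : sg = 1 ∨ sg = -1) (B e vr vi : ℝ) :
    ∃ Y : ℝ → ℝ, AnalyticAt ℝ Y 0 ∧ ∀ t, Real.log 2 < t → ∀ b p q,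
      rotRe ω p q (sg * t) = vr → rotIm ω p q (sg * t) = vi →
      endAmp β δ Mc Ms sg b e p q = B →
      Real.exp (-t) ^ m * jet m φ (homOrbit (sg * t)) (varSol β δ ω b e p q (sg * t))
        = Y (Real.exp (-t)) := by
  obtain ⟨Ξ₀, Ξ₁, h₀, h₁, h⟩ := hexp sg hsg e vr vi
  refine ⟨fun s => jet m φ (endOrbit sg s) (B • Ξ₀ s + s • Ξ₁ s),
    analyticAt_jet m hφ (analyticAt_endOrbit sg 0) (by rwa [endOrbit_zero]) fun i =>
      (analyticAt_const.mul (h₀ i)).add (analyticAt_id.mul (h₁ i)), ?_⟩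
  intro t ht b p q hr hi hB
  rw [← jet_smul, h t ht b p q hr hi, hB, homOrbit_end hsg]

theorem EndExpansion.exists_tendsto_jet (hexp : EndExpansion β δ ω Mc Ms) (hω : 0 < ω)
    (h0U : (0 : Fin 5 → ℝ) ∈ U) {sg : ℝ} (hsg : sg = 1 ∨ sg = -1) {b e p q : ℝ}
    (hB : endAmp β δ Mc Ms sg b e p q = 0) :
    ∃ ξ : Fin 5 → ℝ, ∀ (k : ℕ) (φ : (Fin 5 → ℝ) → ℝ), AnalyticOnNhd ℝ φ U →
      Tendsto (fun j : ℕ => jet k φ (homOrbit (sg * (j * (2 * Real.pi / ω))))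
        (varSol β δ ω b e p q (sg * (j * (2 * Real.pi / ω))))) atTop (𝓝 (jet k φ 0 ξ)) := by
  obtain ⟨Ξ₀, Ξ₁, h₀, h₁, h⟩ := hexp sg hsg e p q
  refine ⟨Ξ₁ 0, fun k φ hφ => ?_⟩
  have hY : AnalyticAt ℝ (fun s => jet k φ (endOrbit sg s) (Ξ₁ s)) 0 :=
    analyticAt_jet k hφ (analyticAt_endOrbit sg 0) (by rwa [endOrbit_zero]) h₁
  have hlim := hY.continuousAt.tendsto.comp (tendsto_exp_neg_period hω)
  simp only [endOrbit_zero] at hlim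
  refine hlim.congr' ?_
  have hev : ∀ᶠ j : ℕ in atTop, Real.log 2 < j * (2 * Real.pi / ω) :=
    (tendsto_natCast_atTop_atTop.atTop_mul_const (by positivity)).eventually_gt_atTop _
  filter_upwards [hev] with j hj
  have hrot := rot_period hω p q hsg j
  have he := h _ hj b p q hrot.1 hrot.2
  rw [hB, zero_smul, zero_add] at he
  have := smul_right_injective (Fin 5 → ℝ) (Real.exp_pos _).ne' he
  rw [this, homOrbit_end hsg]
  rfl

theorem EndExpansion.tendsto_hom (hω : 0 < ω) {sg : ℝ} (hsg : sg = 1 ∨ sg = -1) :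
    Tendsto (fun j : ℕ => hom₂ (sg * (j * (2 * Real.pi / ω)))) atTop (𝓝 0) ∧
      Tendsto (fun j : ℕ => hom₃ (sg * (j * (2 * Real.pi / ω)))) atTop (𝓝 0) := by
  have hs := tendsto_exp_neg_period hω
  constructor
  · have h := ((hs.mul ((analyticAt_endCoef₂ 0).continuousAt.tendsto.comp hs))).const_mul sg
    simp only [zero_mul, mul_zero] at h
    exact h.congr fun j => (hom₂_end hsg _).symm
  · have h := hs.mul ((analyticAt_endCoef₃ 0).continuousAt.tendsto.comp hs)
    simp only [zero_mul] at h
    exact h.congr fun j => (hom₃_end hsg _).symm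

/-- A pair of functions transported by the Duffing flow like the components of a normal
covector, or of a vector, up to a multiple `l` of the damping. -/
structure DuffingPair (β δ ω l : ℝ) (U : Set (Fin 5 → ℝ)) (g₁ g₂ : (Fin 5 → ℝ) → ℝ) : Prop where
  isOpen : IsOpen U
  orbit_mem : ∀ t, homOrbit t ∈ U
  zero_mem : (0 : Fin 5 → ℝ) ∈ U
  analytic₁ : AnalyticOnNhd ℝ g₁ U
  analytic₂ : AnalyticOnNhd ℝ g₂ U
  lie₁ : ∀ x ∈ U, lieDeriv (duffingField β δ ω) g₁ x = g₂ x + (δ + l) * x 2 * g₁ x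
  lie₂ : ∀ x ∈ U, lieDeriv (duffingField β δ ω) g₂ x
    = (1 - 3 * x 0 ^ 2) * g₁ x + l * x 2 * g₂ x

theorem hasDerivAt_jet_varSol (hU : IsOpen U) (hΓ : ∀ t, homOrbit t ∈ U)
    {φ : (Fin 5 → ℝ) → ℝ} (h : AnalyticOnNhd ℝ φ U) {m : ℕ}
    (h0 : ∀ j < m, ∀ t ξ, jet j φ (homOrbit t) ξ = 0) (b e p q t : ℝ) :
    HasDerivAt (fun r => jet m φ (homOrbit r) (varSol β δ ω b e p q r))
      (jet m (lieDeriv (duffingField β δ ω) φ) (homOrbit t) (varSol β δ ω b e p q t)) t := by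
  obtain ⟨κ, hκ⟩ := exists_hasDerivAt_varSol β δ ω b e p q t
  exact hasDerivAt_jet_of_variational hU (analyticOnNhd_duffingField β δ ω U) h
    (hasDerivAt_homOrbit β δ ω) hΓ h0 hκ

namespace DuffingPair
variable {l : ℝ} {g₁ g₂ : (Fin 5 → ℝ) → ℝ} {m : ℕ}

theorem hasDerivAt_jet₁ (H : DuffingPair β δ ω l U g₁ g₂)
    (h₁ : ∀ j < m, ∀ t ξ, jet j g₁ (homOrbit t) ξ = 0) (b e p q t : ℝ) :
    HasDerivAt (fun r => jet m g₁ (homOrbit r) (varSol β δ ω b e p q r))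
      (jet m g₂ (homOrbit t) (varSol β δ ω b e p q t)) t := by
  have hc : AnalyticOnNhd ℝ (fun y : Fin 5 → ℝ => (δ + l) * y 2) U :=
    analyticOnNhd_const.mul (analyticOnNhd_coord 2 U)
  refine (hasDerivAt_jet_varSol H.isOpen H.orbit_mem H.analytic₁ h₁ b e p q t).congr_deriv ?_
  rw [jet_congr H.isOpen m (fun x hx => H.lie₁ x hx) (H.orbit_mem t),
    jet_add H.isOpen m H.analytic₂ (hc.mul H.analytic₁) (H.orbit_mem t),
    jet_mul_leading H.isOpen m hc H.analytic₁ (H.orbit_mem t) _ fun i hi => h₁ i hi t _]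
  simp [homOrbit]

theorem hasDerivAt_jet₂ (H : DuffingPair β δ ω l U g₁ g₂)
    (h₁ : ∀ j < m, ∀ t ξ, jet j g₁ (homOrbit t) ξ = 0)
    (h₂ : ∀ j < m, ∀ t ξ, jet j g₂ (homOrbit t) ξ = 0) (b e p q t : ℝ) :
    HasDerivAt (fun r => jet m g₂ (homOrbit r) (varSol β δ ω b e p q r))
      ((1 - 3 * hom₁ t ^ 2) * jet m g₁ (homOrbit t) (varSol β δ ω b e p q t)) t := by
  have hc : AnalyticOnNhd ℝ (fun y : Fin 5 → ℝ => l * y 2) U :=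
    analyticOnNhd_const.mul (analyticOnNhd_coord 2 U)
  have hd : AnalyticOnNhd ℝ (fun y : Fin 5 → ℝ => 1 - 3 * y 0 ^ 2) U :=
    analyticOnNhd_const.sub (analyticOnNhd_const.mul ((analyticOnNhd_coord 0 U).pow 2))
  refine (hasDerivAt_jet_varSol H.isOpen H.orbit_mem H.analytic₂ h₂ b e p q t).congr_deriv ?_
  rw [jet_congr H.isOpen m (fun x hx => H.lie₂ x hx) (H.orbit_mem t),
    jet_add H.isOpen m (hd.mul H.analytic₁) (hc.mul H.analytic₂) (H.orbit_mem t),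
    jet_mul_leading H.isOpen m hc H.analytic₂ (H.orbit_mem t) _ fun i hi => h₂ i hi t _,
    jet_mul_leading H.isOpen m hd H.analytic₁ (H.orbit_mem t) _ fun i hi => h₁ i hi t _]
  simp [homOrbit]

theorem normal_const (H : DuffingPair β δ ω l U g₁ g₂)
    (h₁ : ∀ j < m, ∀ t ξ, jet j g₁ (homOrbit t) ξ = 0)
    (h₂ : ∀ j < m, ∀ t ξ, jet j g₂ (homOrbit t) ξ = 0) (b e p q t : ℝ) :
    hom₂ t * jet m g₂ (homOrbit t) (varSol β δ ω b e p q t)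
        - hom₃ t * jet m g₁ (homOrbit t) (varSol β δ ω b e p q t)
      = hom₂ 0 * jet m g₂ (homOrbit 0) (varSol β δ ω b e p q 0)
        - hom₃ 0 * jet m g₁ (homOrbit 0) (varSol β δ ω b e p q 0) := by
  have hd : ∀ r, HasDerivAt (fun r => hom₂ r * jet m g₂ (homOrbit r) (varSol β δ ω b e p q r)
        - hom₃ r * jet m g₁ (homOrbit r) (varSol β δ ω b e p q r)) 0 r := fun r =>
    (((hasDerivAt_hom₂ r).mul (H.hasDerivAt_jet₂ h₁ h₂ b e p q r)).sub
      ((hasDerivAt_hom₃ r).mul (H.hasDerivAt_jet₁ h₁ b e p q r))).congr_deriv (by ring)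
  exact is_const_of_deriv_eq_zero (fun r => (hd r).differentiableAt) (fun r => (hd r).deriv) t 0

theorem normal_eq_zero_varSol (H : DuffingPair β δ ω l U g₁ g₂) (hβ : 0 < β) (hω : 0 < ω)
    (hMs : Ms ≠ 0) (hexp : EndExpansion β δ ω Mc Ms)
    (h₁ : ∀ j < m, ∀ t ξ, jet j g₁ (homOrbit t) ξ = 0)
    (h₂ : ∀ j < m, ∀ t ξ, jet j g₂ (homOrbit t) ξ = 0) {b e p q : ℝ}
    (hpq : 0 < p ^ 2 + q ^ 2) :
    hom₂ 0 * jet m g₂ (homOrbit 0) (varSol β δ ω b e p q 0)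
        - hom₃ 0 * jet m g₁ (homOrbit 0) (varSol β δ ω b e p q 0) = 0 := by
  set K : ℝ → ℝ → ℝ → ℝ → ℝ := fun b e p q =>
    hom₂ 0 * jet m g₂ (homOrbit 0) (varSol β δ ω b e p q 0)
        - hom₃ 0 * jet m g₁ (homOrbit 0) (varSol β δ ω b e p q 0) with hKdef
  set b' := -(β * (p * Mc - 1 * q * Ms) - 1 * (δ * e * (2 / 3))) with hb'
  have hB : endAmp β δ Mc Ms 1 b' e p q = 0 := by rw [endAmp, hb']; ring
  have hKK : K b e p q = K b' e p q := by
    refine eq_of_analytic_ends (N := m) (T := Real.log 2) hβ hω hMs (δ := δ) (Mc := Mc) ?_ rfl hpq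
    intro sg hsg B e vr vi
    obtain ⟨Y₁, hY₁, hY₁'⟩ := hexp.exists_analytic_jet H.zero_mem H.analytic₁ m hsg B e vr vi
    obtain ⟨Y₂, hY₂, hY₂'⟩ := hexp.exists_analytic_jet H.zero_mem H.analytic₂ m hsg B e vr vi
    refine ⟨fun s => sg * (s * endCoef₂ s) * Y₂ s - s * endCoef₃ s * Y₁ s,
      ((analyticAt_const.mul (analyticAt_id.mul (analyticAt_endCoef₂ 0))).mul hY₂).sub
        ((analyticAt_id.mul (analyticAt_endCoef₃ 0)).mul hY₁), ?_⟩
    intro t ht b p q hr hi hB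
    rw [hKdef]
    dsimp only
    rw [← H.normal_const h₁ h₂ b e p q (sg * t), ← hY₁' t ht b p q hr hi hB,
      ← hY₂' t ht b p q hr hi hB, hom₂_end hsg, hom₃_end hsg]
    ring
  change K b e p q = 0
  rw [hKK]
  obtain ⟨ξ, hξ⟩ := hexp.exists_tendsto_jet hω H.zero_mem (Or.inl rfl) hB
  obtain ⟨ht₂, ht₃⟩ := EndExpansion.tendsto_hom hω (sg := 1) (Or.inl rfl)
  have hlim := (ht₂.mul (hξ m g₂ H.analytic₂)).sub (ht₃.mul (hξ m g₁ H.analytic₁))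
  simp only [zero_mul, sub_zero] at hlim
  refine tendsto_nhds_unique (tendsto_const_nhds.congr fun j => ?_) hlim
  exact (H.normal_const h₁ h₂ b' e p q _).symm

theorem normal_eq_zero (H : DuffingPair β δ ω l U g₁ g₂) (hβ : 0 < β) (hω : 0 < ω)
    (hMs : Ms ≠ 0) (hexp : EndExpansion β δ ω Mc Ms)
    (h₁ : ∀ j < m, ∀ t ξ, jet j g₁ (homOrbit t) ξ = 0)
    (h₂ : ∀ j < m, ∀ t ξ, jet j g₂ (homOrbit t) ξ = 0) (t : ℝ) (ξ : Fin 5 → ℝ) :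
    hom₂ t * jet m g₂ (homOrbit t) ξ - hom₃ t * jet m g₁ (homOrbit t) ξ = 0 := by
  have key : ∀ ξ : Fin 5 → ℝ, 0 < ξ 3 ^ 2 + ξ 4 ^ 2 →
      hom₂ t * jet m g₂ (homOrbit t) ξ + -hom₃ t * jet m g₁ (homOrbit t) ξ = 0 := by
    intro ξ hξ
    obtain ⟨b, p, q, κ, he, hpq⟩ := exists_eq_varSol β δ ω t ξ
    rw [he, jet_add_smul_velocity H.isOpen H.analytic₂ (hasDerivAt_homOrbit β δ ω) H.orbit_mem h₂,
      jet_add_smul_velocity H.isOpen H.analytic₁ (hasDerivAt_homOrbit β δ ω) H.orbit_mem h₁,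
      neg_mul, ← sub_eq_add_neg, H.normal_const h₁ h₂]
    exact H.normal_eq_zero_varSol hβ hω hMs hexp h₁ h₂ (by rwa [hpq])
  have hev : ∀ᶠ ξ : Fin 5 → ℝ in 𝓝 ![0, 0, 0, 1, 0], 0 < ξ 3 ^ 2 + ξ 4 ^ 2 := by
    refine (isOpen_lt continuous_const (by fun_prop)).mem_nhds ?_
    simp
  have := jet_comb_eq_zero_of_eventually m H.analytic₂ H.analytic₁ (H.orbit_mem t) (hom₂ t)
    (-hom₃ t) (hev.mono key) ξ
  linarith

end DuffingPair
end

/-- Tangential amplitude of the leading jets of a pair of functions on the homoclinic orbit. -/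
noncomputable def tanAmp (β δ ω : ℝ) (m : ℕ) (g₁ g₂ : (Fin 5 → ℝ) → ℝ) (b e p q : ℝ) : ℝ :=
  (hom₂ 0 * jet m g₁ (homOrbit 0) (varSol β δ ω b e p q 0)
    + hom₃ 0 * jet m g₂ (homOrbit 0) (varSol β δ ω b e p q 0)) / homSpeedSq 0

namespace DuffingPair
variable {β δ ω Mc Ms l : ℝ} {U : Set (Fin 5 → ℝ)} {g₁ g₂ : (Fin 5 → ℝ) → ℝ} {m : ℕ}

theorem jet_eq_tanAmp (H : DuffingPair β δ ω l U g₁ g₂)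
    (h₁ : ∀ j < m, ∀ t ξ, jet j g₁ (homOrbit t) ξ = 0)
    (h₂ : ∀ j < m, ∀ t ξ, jet j g₂ (homOrbit t) ξ = 0)
    (hn : ∀ t ξ, hom₂ t * jet m g₂ (homOrbit t) ξ - hom₃ t * jet m g₁ (homOrbit t) ξ = 0)
    (b e p q t : ℝ) :
    jet m g₁ (homOrbit t) (varSol β δ ω b e p q t) = tanAmp β δ ω m g₁ g₂ b e p q * hom₂ t ∧
      jet m g₂ (homOrbit t) (varSol β δ ω b e p q t)
        = tanAmp β δ ω m g₁ g₂ b e p q * hom₃ t := by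
  set y₁ : ℝ → ℝ := fun t => jet m g₁ (homOrbit t) (varSol β δ ω b e p q t) with hy₁
  set y₂ : ℝ → ℝ := fun t => jet m g₂ (homOrbit t) (varSol β δ ω b e p q t) with hy₂
  set a : ℝ → ℝ := fun t => (hom₂ t * y₁ t + hom₃ t * y₂ t) / homSpeedSq t with ha
  have hd₁ : ∀ r, HasDerivAt y₁ (y₂ r) r := H.hasDerivAt_jet₁ h₁ b e p q
  have hd₂ : ∀ r, HasDerivAt y₂ ((1 - 3 * hom₁ r ^ 2) * y₁ r) r :=
    H.hasDerivAt_jet₂ h₁ h₂ b e p q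
  have hn' : ∀ r, hom₂ r * y₂ r - hom₃ r * y₁ r = 0 := fun r => hn r _
  have e₁ : ∀ r, y₁ r = a r * hom₂ r := by
    intro r
    have hΔ := (homSpeedSq_pos r).ne'
    rw [ha]; dsimp only
    field_simp
    rw [homSpeedSq]
    linear_combination (-hom₃ r) * hn' r
  have e₂ : ∀ r, y₂ r = a r * hom₃ r := by
    intro r
    have hΔ := (homSpeedSq_pos r).ne'
    rw [ha]; dsimp only
    field_simp
    rw [homSpeedSq]
    linear_combination (hom₂ r) * hn' r
  have hd : ∀ r, HasDerivAt a 0 r := by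
    intro r
    have hΔ := (homSpeedSq_pos r).ne'
    refine ((((hasDerivAt_hom₂ r).mul (hd₁ r)).add ((hasDerivAt_hom₃ r).mul (hd₂ r))).div
      (hasDerivAt_homSpeedSq r) hΔ).congr_deriv ?_
    rw [div_eq_zero_iff]
    left
    simp only [Pi.add_apply, Pi.mul_apply]
    rw [e₁ r, e₂ r, homSpeedSq]
    ring
  have hc : a t = tanAmp β δ ω m g₁ g₂ b e p q :=
    is_const_of_deriv_eq_zero (fun r => (hd r).differentiableAt) (fun r => (hd r).deriv) t 0
  rw [← hc]
  exact ⟨e₁ t, e₂ t⟩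

theorem tanAmp_eq (H : DuffingPair β δ ω l U g₁ g₂) (hβ : 0 < β) (hω : 0 < ω)
    (hMs : Ms ≠ 0) (hexp : EndExpansion β δ ω Mc Ms)
    (h₁ : ∀ j < m, ∀ t ξ, jet j g₁ (homOrbit t) ξ = 0)
    (h₂ : ∀ j < m, ∀ t ξ, jet j g₂ (homOrbit t) ξ = 0)
    (hn : ∀ t ξ, hom₂ t * jet m g₂ (homOrbit t) ξ - hom₃ t * jet m g₁ (homOrbit t) ξ = 0)
    {b e p q b' p' q' : ℝ} (hpq : p ^ 2 + q ^ 2 = p' ^ 2 + q' ^ 2) (hpos : 0 < p ^ 2 + q ^ 2) :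
    tanAmp β δ ω m g₁ g₂ b e p q = tanAmp β δ ω m g₁ g₂ b' e p' q' := by
  refine eq_of_analytic_ends (N := m + 1) (T := Real.log 2) hβ hω hMs (δ := δ) (Mc := Mc)
    ?_ hpq hpos
  intro sg hsg B e vr vi
  obtain ⟨Y₁, hY₁, hY₁'⟩ := hexp.exists_analytic_jet H.zero_mem H.analytic₁ m hsg B e vr vi
  obtain ⟨Y₂, hY₂, hY₂'⟩ := hexp.exists_analytic_jet H.zero_mem H.analytic₂ m hsg B e vr vi
  have hsg2 : sg ^ 2 = 1 := by rcases hsg with rfl | rfl <;> norm_num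
  have h0 : endCoef₂ 0 ^ 2 + endCoef₃ 0 ^ 2 ≠ 0 := by simp [endCoef₂, endCoef₃, endCoef₁]
  refine ⟨fun s => (sg * endCoef₂ s * Y₁ s + endCoef₃ s * Y₂ s)
      / (endCoef₂ s ^ 2 + endCoef₃ s ^ 2),
    (((analyticAt_const.mul (analyticAt_endCoef₂ 0)).mul hY₁).add
      ((analyticAt_endCoef₃ 0).mul hY₂)).div
      (((analyticAt_endCoef₂ 0).pow 2).add ((analyticAt_endCoef₃ 0).pow 2)) h0, ?_⟩
  intro t ht b p q hr hi hB
  have hN : endCoef₂ (Real.exp (-t)) ^ 2 + endCoef₃ (Real.exp (-t)) ^ 2 ≠ 0 := by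
    have := homSpeedSq_pos (sg * t)
    rw [homSpeedSq_end hsg] at this
    exact (pos_of_mul_pos_right this (by positivity)).ne'
  have hj := H.jet_eq_tanAmp h₁ h₂ hn b e p q (sg * t)
  dsimp only
  rw [← hY₁' t ht b p q hr hi hB, ← hY₂' t ht b p q hr hi hB, hj.1, hj.2, hom₂_end hsg,
    hom₃_end hsg, eq_div_iff hN]
  linear_combination (-Real.exp (-t) ^ (m + 1) * tanAmp β δ ω m g₁ g₂ b e p q
    * endCoef₂ (Real.exp (-t)) ^ 2) * hsg2

/-- The component of the pair normal to the Duffing field. -/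
noncomputable def normalPart (β δ ω : ℝ) (g₁ g₂ : (Fin 5 → ℝ) → ℝ) (x : Fin 5 → ℝ) : ℝ :=
  x 1 * g₂ x + -duffingField β δ ω x 1 * g₁ x

theorem analytic_normalPart (H : DuffingPair β δ ω l U g₁ g₂) :
    AnalyticOnNhd ℝ (normalPart β δ ω g₁ g₂) U :=
  ((analyticOnNhd_coord 1 U).mul H.analytic₂).add
    ((analyticOnNhd_duffingField β δ ω U 1).neg.mul H.analytic₁)

theorem lieDeriv_normalPart (H : DuffingPair β δ ω l U g₁ g₂) {x : Fin 5 → ℝ} (hx : x ∈ U) :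
    lieDeriv (duffingField β δ ω) (normalPart β δ ω g₁ g₂) x
      = l * x 2 * normalPart β δ ω g₁ g₂ x + β * ω * x 4 * g₁ x := by
  have hf := analyticOnNhd_duffingField β δ ω U 1 x hx
  have hc := analyticOnNhd_coord 1 U x hx
  have hf' : AnalyticAt ℝ (fun y => -duffingField β δ ω y 1) x := hf.neg
  have hp : AnalyticAt ℝ (fun y => y 1 * g₂ y) x := hc.mul (H.analytic₂ x hx)
  have hp' : AnalyticAt ℝ (fun y => -duffingField β δ ω y 1 * g₁ y) x :=
    hf'.mul (H.analytic₁ x hx)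
  change lieDeriv _ (fun y => y 1 * g₂ y + -duffingField β δ ω y 1 * g₁ y) x = _
  rw [lieDeriv_add _ hp hp',
    lieDeriv_mul _ hc (H.analytic₂ x hx), lieDeriv_mul _ hf' (H.analytic₁ x hx),
    lieDeriv_coord, lieDeriv_neg, H.lie₁ x hx, H.lie₂ x hx, lieDeriv_eq_fderiv,
    fderiv_duffingField_apply, normalPart]
  simp [duffingField]
  ring

theorem jet_normalPart (H : DuffingPair β δ ω l U g₁ g₂) {x : Fin 5 → ℝ} (hx : x ∈ U) (j : ℕ)
    (ξ : Fin 5 → ℝ) (h₁ : ∀ i, i + 1 < j → jet i g₁ x ξ = 0)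
    (h₂ : ∀ i, i + 1 < j → jet i g₂ x ξ = 0) :
    jet j (normalPart β δ ω g₁ g₂) x ξ
      = (x 1 * jet j g₂ x ξ + j * (ξ 1 * jet (j - 1) g₂ x ξ))
        + (-duffingField β δ ω x 1 * jet j g₁ x ξ
          + j * (jet 1 (fun y => -duffingField β δ ω y 1) x ξ * jet (j - 1) g₁ x ξ)) := by
  have hf : AnalyticOnNhd ℝ (fun y => -duffingField β δ ω y 1) U :=
    (analyticOnNhd_duffingField β δ ω U 1).neg
  have hc := analyticOnNhd_coord 1 U
  change jet j (fun y => y 1 * g₂ y + -duffingField β δ ω y 1 * g₁ y) x ξ = _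
  rw [jet_add H.isOpen j (hc.mul H.analytic₂) (hf.mul H.analytic₁) hx,
    jet_mul_of_vanish H.isOpen j hc H.analytic₂ hx ξ h₂,
    jet_mul_of_vanish H.isOpen j hf H.analytic₁ hx ξ h₁,
    jet_one (fun y : Fin 5 → ℝ => y 1), fderiv_coord]

theorem jet_normalPart_eq_zero (H : DuffingPair β δ ω l U g₁ g₂)
    (h₁ : ∀ j < m, ∀ t ξ, jet j g₁ (homOrbit t) ξ = 0)
    (h₂ : ∀ j < m, ∀ t ξ, jet j g₂ (homOrbit t) ξ = 0)
    (hn : ∀ t ξ, hom₂ t * jet m g₂ (homOrbit t) ξ - hom₃ t * jet m g₁ (homOrbit t) ξ = 0)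
    {j : ℕ} (hj : j < m + 1) (t : ℝ) (ξ : Fin 5 → ℝ) :
    jet j (normalPart β δ ω g₁ g₂) (homOrbit t) ξ = 0 := by
  rw [H.jet_normalPart (H.orbit_mem t) j ξ (fun i hi => h₁ i (by omega) t ξ)
    (fun i hi => h₂ i (by omega) t ξ), duffingField_homOrbit]
  have hpred : (j : ℝ) * (ξ 1 * jet (j - 1) g₂ (homOrbit t) ξ) = 0 ∧
      (j : ℝ) * (jet 1 (fun y => -duffingField β δ ω y 1) (homOrbit t) ξ
        * jet (j - 1) g₁ (homOrbit t) ξ) = 0 := by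
    rcases j with _ | j
    · simp
    · rw [Nat.add_sub_cancel, h₁ j (by omega), h₂ j (by omega)]; simp
  rw [hpred.1, hpred.2]
  rcases Nat.lt_succ_iff_lt_or_eq.1 hj with h | rfl
  · rw [h₁ j h, h₂ j h]; simp
  · have := hn t ξ
    simp only [homOrbit, Matrix.cons_val_one, Matrix.cons_val_zero]
    simp only [homOrbit] at this
    linarith

theorem jet_normalPart_varSol (H : DuffingPair β δ ω l U g₁ g₂)
    (h₁ : ∀ j < m, ∀ t ξ, jet j g₁ (homOrbit t) ξ = 0)
    (h₂ : ∀ j < m, ∀ t ξ, jet j g₂ (homOrbit t) ξ = 0)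
    (hn : ∀ t ξ, hom₂ t * jet m g₂ (homOrbit t) ξ - hom₃ t * jet m g₁ (homOrbit t) ξ = 0)
    (b e p q t : ℝ) :
    jet (m + 1) (normalPart β δ ω g₁ g₂) (homOrbit t) (varSol β δ ω b e p q t)
        - (m + 1) * (β * ω) * tanAmp β δ ω m g₁ g₂ b e p q
          * (p * melSin ω t + q * melCos ω t)
      = jet (m + 1) (normalPart β δ ω g₁ g₂) (homOrbit 0) (varSol β δ ω b e p q 0) := by
  have hN := H.analytic_normalPart
  have hc : AnalyticOnNhd ℝ (fun y : Fin 5 → ℝ => l * y 2) U :=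
    analyticOnNhd_const.mul (analyticOnNhd_coord 2 U)
  have hc' : AnalyticOnNhd ℝ (fun y : Fin 5 → ℝ => β * ω * y 4) U :=
    analyticOnNhd_const.mul (analyticOnNhd_coord 4 U)
  have hv : ∀ j < m + 1, ∀ t ξ, jet j (normalPart β δ ω g₁ g₂) (homOrbit t) ξ = 0 :=
    fun j hj t ξ => H.jet_normalPart_eq_zero h₁ h₂ hn hj t ξ
  have hd : ∀ r, HasDerivAt (fun t =>
      jet (m + 1) (normalPart β δ ω g₁ g₂) (homOrbit t) (varSol β δ ω b e p q t)
        - (m + 1) * (β * ω) * tanAmp β δ ω m g₁ g₂ b e p q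
          * (p * melSin ω t + q * melCos ω t)) 0 r := by
    intro r
    refine ((hasDerivAt_jet_varSol (β := β) (δ := δ) (ω := ω) H.isOpen H.orbit_mem hN hv
      b e p q r).sub ((((hasDerivAt_melSin ω r).const_mul p).add
        ((hasDerivAt_melCos ω r).const_mul q)).const_mul _)).congr_deriv ?_
    have hfd : jet 1 (fun y : Fin 5 → ℝ => β * ω * y 4) (homOrbit r) (varSol β δ ω b e p q r)
        = β * ω * rotIm ω p q r := by
      rw [jet_one, fderiv_const_mul (analyticOnNhd_coord 4 U _ (H.orbit_mem r)).differentiableAt]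
      change β * ω * fderiv ℝ (fun y : Fin 5 → ℝ => y 4) _ _ = _
      rw [fderiv_coord]
      rfl
    rw [jet_congr H.isOpen (m + 1) (fun x hx => H.lieDeriv_normalPart hx) (H.orbit_mem r),
      jet_add H.isOpen (m + 1) (hc.mul hN) (hc'.mul H.analytic₁) (H.orbit_mem r),
      jet_mul_leading H.isOpen (m + 1) hc hN (H.orbit_mem r) _ fun i hi => hv i hi r _,
      jet_mul_of_vanish H.isOpen (m + 1) hc' H.analytic₁ (H.orbit_mem r) _
        fun i hi => h₁ i (by omega) r _, hfd, Nat.add_sub_cancel,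
      (H.jet_eq_tanAmp h₁ h₂ hn b e p q r).1, rotIm]
    simp [homOrbit]
    ring
  have := is_const_of_deriv_eq_zero (fun r => (hd r).differentiableAt) (fun r => (hd r).deriv) t 0
  refine this.trans ?_
  simp [melSin, melCos]

theorem tendsto_jet_normalPart (H : DuffingPair β δ ω l U g₁ g₂) (hω : 0 < ω)
    (hexp : EndExpansion β δ ω Mc Ms)
    (h₁ : ∀ j < m, ∀ t ξ, jet j g₁ (homOrbit t) ξ = 0)
    (h₂ : ∀ j < m, ∀ t ξ, jet j g₂ (homOrbit t) ξ = 0)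
    (hn : ∀ t ξ, hom₂ t * jet m g₂ (homOrbit t) ξ - hom₃ t * jet m g₁ (homOrbit t) ξ = 0)
    {sg : ℝ} (hsg : sg = 1 ∨ sg = -1) {b e p q : ℝ}
    (hB : endAmp β δ Mc Ms sg b e p q = 0) :
    Tendsto (fun j : ℕ => jet (m + 1) (normalPart β δ ω g₁ g₂)
      (homOrbit (sg * (j * (2 * Real.pi / ω))))
      (varSol β δ ω b e p q (sg * (j * (2 * Real.pi / ω))))) atTop (𝓝 0) := by
  obtain ⟨ξ, hξ⟩ := hexp.exists_tendsto_jet hω H.zero_mem hsg hB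
  obtain ⟨ht₂, ht₃⟩ := EndExpansion.tendsto_hom hω hsg
  have hlow : ∀ g : (Fin 5 → ℝ) → ℝ, AnalyticOnNhd ℝ g U →
      (∀ j < m, ∀ t ξ, jet j g (homOrbit t) ξ = 0) → ∀ i < m, jet i g 0 ξ = 0 := by
    intro g hg h i hi
    exact tendsto_nhds_unique (hξ i g hg) (tendsto_const_nhds.congr fun j => (h i hi _ _).symm)
  have htop₁ : jet m g₁ 0 ξ = 0 := by
    have h := ht₂.const_mul (tanAmp β δ ω m g₁ g₂ b e p q)
    rw [mul_zero] at h
    exact tendsto_nhds_unique (hξ m g₁ H.analytic₁)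
      (h.congr fun j => (H.jet_eq_tanAmp h₁ h₂ hn b e p q _).1.symm)
  have htop₂ : jet m g₂ 0 ξ = 0 := by
    have h := ht₃.const_mul (tanAmp β δ ω m g₁ g₂ b e p q)
    rw [mul_zero] at h
    exact tendsto_nhds_unique (hξ m g₂ H.analytic₂)
      (h.congr fun j => (H.jet_eq_tanAmp h₁ h₂ hn b e p q _).2.symm)
  have hz : jet (m + 1) (normalPart β δ ω g₁ g₂) 0 ξ = 0 := by
    rw [H.jet_normalPart H.zero_mem (m + 1) ξ
      (fun i hi => hlow g₁ H.analytic₁ h₁ i (by omega))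
      (fun i hi => hlow g₂ H.analytic₂ h₂ i (by omega)), Nat.add_sub_cancel, htop₁, htop₂]
    simp [duffingField]
  rw [← hz]
  exact hξ (m + 1) _ H.analytic_normalPart

theorem tanAmp_eq_zero_of_resonant (H : DuffingPair β δ ω l U g₁ g₂) (hβ : 0 < β) (hω : 0 < ω)
    (hMs : Ms ≠ 0) (hmel : Tendsto (melSin ω) atTop (𝓝 Ms)) (hexp : EndExpansion β δ ω Mc Ms)
    (h₁ : ∀ j < m, ∀ t ξ, jet j g₁ (homOrbit t) ξ = 0)
    (h₂ : ∀ j < m, ∀ t ξ, jet j g₂ (homOrbit t) ξ = 0)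
    (hn : ∀ t ξ, hom₂ t * jet m g₂ (homOrbit t) ξ - hom₃ t * jet m g₁ (homOrbit t) ξ = 0)
    {e p : ℝ} (hp : p ≠ 0) :
    tanAmp β δ ω m g₁ g₂ (-(β * p * Mc)) e p (-(2 / 3 * δ * e / (β * Ms))) = 0 := by
  set b := -(β * p * Mc) with hb
  set q := -(2 / 3 * δ * e / (β * Ms)) with hq
  have hq' : β * (q * Ms) = -(2 / 3 * δ * e) := by rw [hq]; field_simp
  have hB₁ : endAmp β δ Mc Ms 1 b e p q = 0 := by rw [endAmp, hb]; linear_combination -hq'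
  have hB₂ : endAmp β δ Mc Ms (-1) b e p q = 0 := by rw [endAmp, hb]; linear_combination hq'
  have hlim := (H.tendsto_jet_normalPart hω hexp h₁ h₂ hn (Or.inl rfl) hB₁).sub
    (H.tendsto_jet_normalPart hω hexp h₁ h₂ hn (Or.inr rfl) hB₂)
  have hT : Tendsto (fun j : ℕ => (j : ℝ) * (2 * Real.pi / ω)) atTop atTop :=
    tendsto_natCast_atTop_atTop.atTop_mul_const (by positivity)
  have hlim' := (hmel.comp hT).const_mul
    (2 * ((m + 1) * (β * ω) * tanAmp β δ ω m g₁ g₂ b e p q) * p)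
  have hz := tendsto_nhds_unique hlim' (hlim.congr fun j => by
    have e₁ := H.jet_normalPart_varSol h₁ h₂ hn b e p q (1 * (j * (2 * Real.pi / ω)))
    have e₂ := H.jet_normalPart_varSol h₁ h₂ hn b e p q (-1 * (j * (2 * Real.pi / ω)))
    rw [sub_eq_iff_eq_add] at e₁ e₂
    rw [e₁, e₂, one_mul, neg_one_mul, melSin_neg, melCos_neg, Function.comp_apply]
    ring)
  rw [sub_zero] at hz
  have hm : (m : ℝ) + 1 ≠ 0 := by positivity
  simpa [hm, hβ.ne', hω.ne', hMs, hp] using hz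

theorem jet_eq_zero_of_lower (H : DuffingPair β δ ω l U g₁ g₂) (hβ : 0 < β) (hω : 0 < ω)
    (hMs : Ms ≠ 0) (hmel : Tendsto (melSin ω) atTop (𝓝 Ms)) (hexp : EndExpansion β δ ω Mc Ms)
    (h₁ : ∀ j < m, ∀ t ξ, jet j g₁ (homOrbit t) ξ = 0)
    (h₂ : ∀ j < m, ∀ t ξ, jet j g₂ (homOrbit t) ξ = 0) (t : ℝ) (ξ : Fin 5 → ℝ) :
    jet m g₁ (homOrbit t) ξ = 0 ∧ jet m g₂ (homOrbit t) ξ = 0 := by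
  have hn := H.normal_eq_zero hβ hω hMs hexp h₁ h₂
  have key : ∀ ξ : Fin 5 → ℝ, (2 / 3 * δ * ξ 2 / (β * Ms)) ^ 2 < ξ 3 ^ 2 + ξ 4 ^ 2 →
      jet m g₁ (homOrbit t) ξ = 0 ∧ jet m g₂ (homOrbit t) ξ = 0 := by
    intro ξ hξ
    obtain ⟨b, p, q, κ, he, hpq⟩ := exists_eq_varSol β δ ω t ξ
    set r := 2 / 3 * δ * ξ 2 / (β * Ms) with hr
    have hpos : 0 < ξ 3 ^ 2 + ξ 4 ^ 2 - r ^ 2 := by linarith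
    have hs := Real.sq_sqrt hpos.le
    have hz := H.tanAmp_eq_zero_of_resonant hβ hω hMs hmel hexp h₁ h₂ hn (e := ξ 2)
      (Real.sqrt_pos.2 hpos).ne'
    have hA : tanAmp β δ ω m g₁ g₂ b (ξ 2) p q = 0 := by
      rw [← hz]
      refine H.tanAmp_eq hβ hω hMs hexp h₁ h₂ hn ?_ ?_
      · rw [hs, hpq, neg_sq, ← hr]; ring
      · rw [hpq]; nlinarith [sq_nonneg r]
    have hj := H.jet_eq_tanAmp h₁ h₂ hn b (ξ 2) p q t
    rw [hA, zero_mul, zero_mul] at hj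
    have e₁ := jet_add_smul_velocity H.isOpen H.analytic₁ (hasDerivAt_homOrbit β δ ω) H.orbit_mem
      h₁ t (varSol β δ ω b (ξ 2) p q t) κ
    have e₂ := jet_add_smul_velocity H.isOpen H.analytic₂ (hasDerivAt_homOrbit β δ ω) H.orbit_mem
      h₂ t (varSol β δ ω b (ξ 2) p q t) κ
    rw [← he] at e₁ e₂
    exact ⟨e₁.trans hj.1, e₂.trans hj.2⟩
  have hev : ∀ᶠ ξ : Fin 5 → ℝ in 𝓝 ![0, 0, 0, 1, 0],
      (2 / 3 * δ * ξ 2 / (β * Ms)) ^ 2 < ξ 3 ^ 2 + ξ 4 ^ 2 := by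
    refine (isOpen_lt (by fun_prop) (by fun_prop)).mem_nhds ?_
    simp
  constructor
  · have := jet_comb_eq_zero_of_eventually m H.analytic₁ H.analytic₁ (H.orbit_mem t) 1 0
      (hev.mono fun ξ hξ => by rw [(key ξ hξ).1]; ring) ξ
    simpa using this
  · have := jet_comb_eq_zero_of_eventually m H.analytic₂ H.analytic₂ (H.orbit_mem t) 1 0
      (hev.mono fun ξ hξ => by rw [(key ξ hξ).2]; ring) ξ
    simpa using this

/-- A pair of analytic functions transported by the Duffing field vanishes near the homoclinic
orbit. -/
theorem eventually_eq_zero (H : DuffingPair β δ ω l U g₁ g₂) (hβ : 0 < β) (hω : 0 < ω) :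
    ∀ᶠ y in 𝓝 (homOrbit 0), g₁ y = 0 ∧ g₂ y = 0 := by
  obtain ⟨Mc, Ms, hMs, -, hmel, hexp⟩ := exists_end_expansion β δ hω
  have hall : ∀ m, ∀ t ξ, jet m g₁ (homOrbit t) ξ = 0 ∧ jet m g₂ (homOrbit t) ξ = 0 := by
    intro m
    induction m using Nat.strong_induction_on with
    | _ m ih =>
      exact H.jet_eq_zero_of_lower hβ hω hMs hmel hexp (fun j hj t ξ => (ih j hj t ξ).1)
        (fun j hj t ξ => (ih j hj t ξ).2)
  exact (eventually_eq_zero_of_jet H.isOpen H.analytic₁ (H.orbit_mem 0)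
    fun j ξ => (hall j 0 ξ).1).and (eventually_eq_zero_of_jet H.isOpen H.analytic₂ (H.orbit_mem 0)
    fun j ξ => (hall j 0 ξ).2)

end DuffingPair

section
variable {β δ ω : ℝ} {U : Set (Fin 5 → ℝ)}

theorem lieDeriv_partialDeriv (hU : IsOpen U) {F : (Fin 5 → ℝ) → ℝ} (hF : AnalyticOnNhd ℝ F U)
    (h : ∀ x ∈ U, lieDeriv (duffingField β δ ω) F x = 0) (i : Fin 5) {x : Fin 5 → ℝ}
    (hx : x ∈ U) :
    lieDeriv (duffingField β δ ω) (partialDeriv i F) x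
      = -∑ k, partialDeriv i (fun y => duffingField β δ ω y k) x * partialDeriv k F x := by
  have hz := partialDeriv_congr (ψ := fun _ => 0) hU h i hx
  have hf := fun k => (analyticOnNhd_duffingField β δ ω U k x hx).differentiableAt
  have hp := fun k => (hF.partialDeriv k x hx).differentiableAt
  change fderiv ℝ (fun y => ∑ k, duffingField β δ ω y k * partialDeriv k F y) x (Pi.single i 1)
    = fderiv ℝ (fun _ => 0) x (Pi.single i 1) at hz
  rw [fderiv_fun_sum fun k _ => (hf k).fun_mul (hp k), fderiv_fun_const] at hz
  simp only [sum_apply, fderiv_fun_mul (hf _) (hp _),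
    add_apply, smul_apply, smul_eq_mul,
    Finset.sum_add_distrib, Pi.zero_apply, zero_apply] at hz
  rw [eq_neg_iff_add_eq_zero, ← hz, lieDeriv]
  congr 1
  · exact Finset.sum_congr rfl fun k _ => by rw [partialDeriv_comm hF k i hx]; rfl
  · exact Finset.sum_congr rfl fun k _ => mul_comm _ _

/-- Near the homoclinic orbit the derivative of an analytic first integral annihilates the
phase plane and the direction of the forcing. -/
theorem firstIntegral_eventually (hβ : 0 < β) (hω : 0 < ω) (hU : IsOpen U)
    (hΓ : ∀ t, homOrbit t ∈ U) (h0 : (0 : Fin 5 → ℝ) ∈ U) {F : (Fin 5 → ℝ) → ℝ}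
    (hF : AnalyticOnNhd ℝ F U) (h : ∀ x ∈ U, fderiv ℝ F x (duffingField β δ ω x) = 0) :
    ∀ᶠ y in 𝓝 (homOrbit 0), partialDeriv 0 F y = 0 ∧ partialDeriv 1 F y = 0 ∧
      y 3 * partialDeriv 4 F y = y 4 * partialDeriv 3 F y := by
  have hL : ∀ x ∈ U, lieDeriv (duffingField β δ ω) F x = 0 := fun x hx => by
    rw [lieDeriv_eq_fderiv, h x hx]
  have H : DuffingPair β δ ω 0 U (partialDeriv 1 F) (fun y => -partialDeriv 0 F y) := by
    refine ⟨hU, hΓ, h0, hF.partialDeriv 1, (hF.partialDeriv 0).neg, fun x hx => ?_,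
      fun x hx => ?_⟩
    · rw [lieDeriv_partialDeriv hU hF hL 1 hx, Fin.sum_univ_five]
      simp only [partialDeriv, fderiv_duffingField_apply]
      simp
      ring
    · rw [lieDeriv_neg, lieDeriv_partialDeriv hU hF hL 0 hx, Fin.sum_univ_five]
      simp only [partialDeriv, fderiv_duffingField_apply]
      simp
  filter_upwards [H.eventually_eq_zero hβ hω, hU.mem_nhds (hΓ 0)] with y hy hyU
  have h2 : partialDeriv 0 F y = 0 := neg_eq_zero.1 hy.2
  refine ⟨h2, hy.1, ?_⟩
  have h3 := hL y hyU
  rw [lieDeriv, Fin.sum_univ_five, hy.1, h2] at h3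
  simp [duffingField] at h3
  have : ω * (y 3 * partialDeriv 4 F y - y 4 * partialDeriv 3 F y) = 0 := by linarith
  rcases mul_eq_zero.1 this with h | h
  · exact absurd h hω.ne'
  · linarith

/-- Near the homoclinic orbit an analytic symmetry tangent to the invariant cylinders
`ε = const`, `u₁² + u₂² = const` is parallel to the Duffing field. -/
theorem symmetry_eventually (hβ : 0 < β) (hω : 0 < ω) (hU : IsOpen U)
    (hΓ : ∀ t, homOrbit t ∈ U) (h0 : (0 : Fin 5 → ℝ) ∈ U) {k : (Fin 5 → ℝ) → Fin 5 → ℝ}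
    (hk : ∀ i, AnalyticOnNhd ℝ (fun y => k y i) U)
    (hcomm : ∀ x ∈ U, ∀ i, lieDeriv (duffingField β δ ω) (fun y => k y i) x
      = fderiv ℝ (fun y => duffingField β δ ω y i) x (k x))
    (h2 : ∀ x ∈ U, k x 2 = 0) (hρ : ∀ x ∈ U, x 3 * k x 3 + x 4 * k x 4 = 0) :
    ∀ᶠ y in 𝓝 (homOrbit 0), (ω * (y 3 ^ 2 + y 4 ^ 2)) • k y
      = (y 3 * k y 4 - y 4 * k y 3) • duffingField β δ ω y := by
  have hX := fun i => analyticOnNhd_coord i U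
  have hf := fun i => analyticOnNhd_duffingField β δ ω U i
  set R : (Fin 5 → ℝ) → ℝ := fun y => ω * (y 3 * y 3 + y 4 * y 4) with hR
  set γ : (Fin 5 → ℝ) → ℝ := fun y => y 3 * k y 4 - y 4 * k y 3 with hγ
  have h33 : AnalyticOnNhd ℝ (fun y : Fin 5 → ℝ => y 3 * y 3) U := (hX 3).mul (hX 3)
  have h44 : AnalyticOnNhd ℝ (fun y : Fin 5 → ℝ => y 4 * y 4) U := (hX 4).mul (hX 4)
  have hs : AnalyticOnNhd ℝ (fun y : Fin 5 → ℝ => y 3 * y 3 + y 4 * y 4) U := h33.add h44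
  have hRa : AnalyticOnNhd ℝ R U := analyticOnNhd_const.mul hs
  have h34 : AnalyticOnNhd ℝ (fun y => y 3 * k y 4) U := (hX 3).mul (hk 4)
  have h43 : AnalyticOnNhd ℝ (fun y => y 4 * k y 3) U := (hX 4).mul (hk 3)
  have hγa : AnalyticOnNhd ℝ γ U := h34.sub h43
  have hRL : ∀ x ∈ U, lieDeriv (duffingField β δ ω) R x = 0 := by
    intro x hx
    rw [hR, lieDeriv_mul _ analyticAt_const (hs x hx), lieDeriv_add _ (h33 x hx) (h44 x hx),
      lieDeriv_mul _ (hX 3 x hx) (hX 3 x hx), lieDeriv_mul _ (hX 4 x hx) (hX 4 x hx),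
      lieDeriv_coord, lieDeriv_coord, lieDeriv_eq_fderiv, fderiv_fun_const]
    simp [duffingField]
    ring_nf
    simp
  have hγL : ∀ x ∈ U, lieDeriv (duffingField β δ ω) γ x = 0 := by
    intro x hx
    rw [hγ, lieDeriv_sub _ (h34 x hx) (h43 x hx), lieDeriv_mul _ (hX 3 x hx) (hk 4 x hx),
      lieDeriv_mul _ (hX 4 x hx) (hk 3 x hx), lieDeriv_coord, lieDeriv_coord, hcomm x hx,
      hcomm x hx, fderiv_duffingField_apply, fderiv_duffingField_apply]
    simp [duffingField]
    ring
  have hp0 : AnalyticOnNhd ℝ (fun y => R y * k y 0) U := hRa.mul (hk 0)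
  have hp1 : AnalyticOnNhd ℝ (fun y => R y * k y 1) U := hRa.mul (hk 1)
  have hq0 : AnalyticOnNhd ℝ (fun y => γ y * y 1) U := hγa.mul (hX 1)
  have hq1 : AnalyticOnNhd ℝ (fun y => γ y * duffingField β δ ω y 1) U := hγa.mul (hf 1)
  have H : DuffingPair β δ ω (-δ) U (fun y => R y * k y 0 - γ y * y 1)
      (fun y => R y * k y 1 - γ y * duffingField β δ ω y 1) := by
    refine ⟨hU, hΓ, h0, hp0.sub hq0, hp1.sub hq1, fun x hx => ?_, fun x hx => ?_⟩
    · rw [lieDeriv_sub _ (hp0 x hx) (hq0 x hx), lieDeriv_mul _ (hRa x hx) (hk 0 x hx),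
        lieDeriv_mul _ (hγa x hx) (hX 1 x hx), hRL x hx, hγL x hx, hcomm x hx, lieDeriv_coord,
        fderiv_duffingField_apply]
      simp
    · rw [lieDeriv_sub _ (hp1 x hx) (hq1 x hx), lieDeriv_mul _ (hRa x hx) (hk 1 x hx),
        lieDeriv_mul _ (hγa x hx) (hf 1 x hx), hRL x hx, hγL x hx, hcomm x hx,
        lieDeriv_eq_fderiv, fderiv_duffingField_apply, fderiv_duffingField_apply, h2 x hx]
      simp [duffingField, hR, hγ]
      linear_combination (β * ω * x 3) * hρ x hx
  filter_upwards [H.eventually_eq_zero hβ hω, hU.mem_nhds (hΓ 0)] with y hy hyU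
  have e2 := h2 y hyU
  have eρ := hρ y hyU
  obtain ⟨ha, hb⟩ := hy
  simp only [hR, hγ, duffingField, Matrix.cons_val_one, Matrix.cons_val_zero] at ha hb
  funext i
  fin_cases i
  · simp [duffingField]; linear_combination ha
  · simp [duffingField]; linear_combination hb
  · simp [duffingField, e2]
  · simp [duffingField]; linear_combination (ω * y 3) * eρ
  · simp [duffingField]; linear_combination (ω * y 4) * eρ

theorem exists_mem_of_eventually_of_ae (hU : IsOpen U) {x : Fin 5 → ℝ} (hx : x ∈ U)
    {P Q : (Fin 5 → ℝ) → Prop} (hP : ∀ᶠ y in 𝓝 x, P y)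
    (hQ : ∀ᵐ y ∂volume.restrict U, Q y) : ∃ y ∈ U, y 3 ≠ 0 ∧ P y ∧ Q y := by
  obtain ⟨S, hSP, hSo, hxS⟩ := mem_nhds_iff.1 hP
  have hopen : IsOpen (S ∩ U ∩ {y : Fin 5 → ℝ | y 3 ≠ 0}) :=
    (hSo.inter hU).inter (isOpen_ne_fun (continuous_apply 3) continuous_const)
  have hne : (S ∩ U ∩ {y : Fin 5 → ℝ | y 3 ≠ 0}).Nonempty := by
    by_cases h3 : x 3 = 0
    · have hlim : Tendsto (fun r : ℝ => x + r • (Pi.single 3 1 : Fin 5 → ℝ)) (𝓝[≠] 0) (𝓝 x) := by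
        have : Continuous (fun r : ℝ => x + r • (Pi.single 3 1 : Fin 5 → ℝ)) := by fun_prop
        have := this.tendsto 0
        simp only [zero_smul, add_zero] at this
        exact this.mono_left nhdsWithin_le_nhds
      have hev := hlim.eventually ((hSo.inter hU).mem_nhds ⟨hxS, hx⟩)
      obtain ⟨r, hr, hr0⟩ := (hev.and self_mem_nhdsWithin).exists
      exact ⟨_, hr, by simpa [h3] using hr0⟩
    · exact ⟨x, ⟨hxS, hx⟩, h3⟩
  have hpos := hopen.measure_pos volume hne
  by_contra! hcon
  rw [ae_restrict_iff' hU.measurableSet, ae_iff] at hQ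
  refine hpos.ne' (measure_mono_null (fun y hy => ?_) hQ)
  simp only [Set.mem_ofPred_eq, not_forall]
  exact ⟨hy.1.2, hcon y hy.1.2 hy.2 (hSP hy.1.1)⟩

theorem eventually_eq_zero_of_ae (hU : IsOpen U) {x : Fin 5 → ℝ} (hx : x ∈ U)
    {P Q : (Fin 5 → ℝ) → Prop} (hP : ∀ᶠ y in 𝓝 x, P y)
    (hQ : ∀ᵐ y ∂volume.restrict U, Q y) {c : (Fin 5 → ℝ) → ℝ} (hc : ContinuousOn c U)
    (h : ∀ y ∈ U, y 3 ≠ 0 → P y → Q y → c y = 0) : ∀ᶠ y in 𝓝 x, c y = 0 := by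
  filter_upwards [hP.eventually_nhds, hU.mem_nhds hx] with y hy hyU
  by_contra hcy
  have hcn := (hc.continuousAt (hU.mem_nhds hyU)).eventually_ne hcy
  obtain ⟨z, hzU, hz3, ⟨hzP, hzc⟩, hzQ⟩ := exists_mem_of_eventually_of_ae hU hyU (hy.and hcn) hQ
  exact hzc (h z hzU hz3 hzP hzQ)

/-- First integrals `c i` for which the combination of the symmetries `g i` is tangent to the
invariant cylinders vanish identically. -/
theorem coeff_eq_zero (hβ : 0 < β) (hω : 0 < ω) (hU : IsOpen U) (hUc : IsPreconnected U)
    (hΓ : ∀ t, homOrbit t ∈ U) (h0 : (0 : Fin 5 → ℝ) ∈ U) {n : ℕ}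
    {g : Fin n → (Fin 5 → ℝ) → Fin 5 → ℝ} (hg : ∀ a i, AnalyticOnNhd ℝ (fun y => g a y i) U)
    (hcomm : ∀ a, ∀ x ∈ U, ∀ i, lieDeriv (duffingField β δ ω) (fun y => g a y i) x
      = fderiv ℝ (fun y => duffingField β δ ω y i) x (g a x))
    (hind : ∀ᵐ x ∂volume.restrict U, ∀ (s : ℝ) (c : Fin n → ℝ),
      ∑ a, c a • g a x = s • duffingField β δ ω x → c = 0)
    {c : Fin n → (Fin 5 → ℝ) → ℝ} (hc : ∀ a, AnalyticOnNhd ℝ (c a) U)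
    (hcL : ∀ a, ∀ x ∈ U, lieDeriv (duffingField β δ ω) (c a) x = 0)
    (h2 : ∀ x ∈ U, ∑ a, c a x * g a x 2 = 0)
    (hρ : ∀ x ∈ U, ∑ a, c a x * (x 3 * g a x 3 + x 4 * g a x 4) = 0) (a : Fin n) :
    ∀ x ∈ U, c a x = 0 := by
  set k : (Fin 5 → ℝ) → Fin 5 → ℝ := fun y => ∑ a, c a y • g a y with hk
  have hki : ∀ y i, k y i = ∑ a, c a y * g a y i := fun y i => by
    simp [hk, Finset.sum_apply]
  have hka : ∀ i, AnalyticOnNhd ℝ (fun y => k y i) U := by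
    intro i
    simp only [hki]
    exact Finset.analyticOnNhd_fun_sum _ fun a _ => (hc a).mul (hg a i)
  have hkL : ∀ x ∈ U, ∀ i, lieDeriv (duffingField β δ ω) (fun y => k y i) x
      = fderiv ℝ (fun y => duffingField β δ ω y i) x (k x) := by
    intro x hx i
    simp only [hki]
    rw [lieDeriv_eq_fderiv, fderiv_fun_sum fun a _ =>
      ((hc a x hx).differentiableAt.fun_mul (hg a i x hx).differentiableAt), hk, map_sum,
      sum_apply]
    refine Finset.sum_congr rfl fun a _ => ?_
    rw [← lieDeriv_eq_fderiv, lieDeriv_mul _ (hc a x hx) (hg a i x hx), hcL a x hx,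
      hcomm a x hx i, map_smul]
    simp
  have hev := symmetry_eventually hβ hω hU hΓ h0 hka hkL (fun x hx => by rw [hki]; exact h2 x hx)
    (fun x hx => by
      rw [hki, hki, Finset.mul_sum, Finset.mul_sum, ← Finset.sum_add_distrib, ← hρ x hx]
      exact Finset.sum_congr rfl fun a _ => by ring)
  have hz := eventually_eq_zero_of_ae hU (hΓ 0) hev hind (hc a).continuousOn
    fun y hyU hy3 hP hQ => by
      have hr : ω * (y 3 ^ 2 + y 4 ^ 2) ≠ 0 := by positivity
      rw [hk, Finset.smul_sum] at hP
      simp only [smul_smul] at hP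
      have := congrFun (hQ _ (fun a => ω * (y 3 ^ 2 + y 4 ^ 2) * c a y) hP) a
      simpa [hr] using this
  exact (hc a).eqOn_zero_of_preconnected_of_eventuallyEq_zero hUc (hΓ 0) hz

end

theorem BogoyavlenskijIntegrable.mono {E : Type*} [NormedAddCommGroup E] [NormedSpace ℝ E]
    [MeasureSpace E] {f : E → E} {U V : Set E} {q m : ℕ} (hVU : V ⊆ U)
    (h : BogoyavlenskijIntegrable f U q m) : BogoyavlenskijIntegrable f V q m := by
  obtain ⟨fs, Fs, hf, hfs, hFs, hcomm, hind, hFind, h_int⟩ := h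
  exact ⟨fs, Fs, fun h x hx => hf h x (hVU hx), fun j => (hfs j).mono hVU,
    fun k => (hFs k).mono hVU, fun j k x hx => hcomm j k x (hVU hx),
    ae_restrict_of_ae_restrict_of_subset hVU hind,
    ae_restrict_of_ae_restrict_of_subset hVU hFind, fun k j x hx => h_int k j x (hVU hx)⟩

section
variable {β δ ω : ℝ} {U : Set (Fin 5 → ℝ)}

/-- No three commuting symmetries of the Duffing field are independent of it. -/
theorem not_three_symmetries (hβ : 0 < β) (hω : 0 < ω) (hU : IsOpen U) (hUc : IsPreconnected U)
    (hΓ : ∀ t, homOrbit t ∈ U) (h0 : (0 : Fin 5 → ℝ) ∈ U)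
    {g : Fin 3 → (Fin 5 → ℝ) → Fin 5 → ℝ} (hg : ∀ a i, AnalyticOnNhd ℝ (fun y => g a y i) U)
    (hcomm : ∀ a, ∀ x ∈ U, ∀ i, lieDeriv (duffingField β δ ω) (fun y => g a y i) x
      = fderiv ℝ (fun y => duffingField β δ ω y i) x (g a x))
    (hind : ∀ᵐ x ∂volume.restrict U, ∀ (s : ℝ) (c : Fin 3 → ℝ),
      ∑ a, c a • g a x = s • duffingField β δ ω x → c = 0) : False := by
  set E : Fin 3 → (Fin 5 → ℝ) → ℝ := fun a x => g a x 2 with hE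
  set ρ : Fin 3 → (Fin 5 → ℝ) → ℝ := fun a x => x 3 * g a x 3 + x 4 * g a x 4 with hρ
  have hX := fun i => analyticOnNhd_coord i U
  have hEa : ∀ a, AnalyticOnNhd ℝ (E a) U := fun a => hg a 2
  have h33 : ∀ a, AnalyticOnNhd ℝ (fun x => x 3 * g a x 3) U := fun a => (hX 3).mul (hg a 3)
  have h44 : ∀ a, AnalyticOnNhd ℝ (fun x => x 4 * g a x 4) U := fun a => (hX 4).mul (hg a 4)
  have hρa : ∀ a, AnalyticOnNhd ℝ (ρ a) U := fun a => (h33 a).add (h44 a)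
  have hEL : ∀ a, ∀ x ∈ U, lieDeriv (duffingField β δ ω) (E a) x = 0 := fun a x hx => by
    rw [hE, hcomm a x hx, fderiv_duffingField_apply]; rfl
  have hρL : ∀ a, ∀ x ∈ U, lieDeriv (duffingField β δ ω) (ρ a) x = 0 := fun a x hx => by
    rw [hρ, lieDeriv_add _ (h33 a x hx) (h44 a x hx), lieDeriv_mul _ (hX 3 x hx) (hg a 3 x hx),
      lieDeriv_mul _ (hX 4 x hx) (hg a 4 x hx), lieDeriv_coord, lieDeriv_coord, hcomm a x hx,
      hcomm a x hx, fderiv_duffingField_apply, fderiv_duffingField_apply]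
    simp [duffingField]
    ring
  have hCL : ∀ a b, ∀ x ∈ U,
      lieDeriv (duffingField β δ ω) (fun x => E a x * ρ b x - E b x * ρ a x) x = 0 := by
    intro a b x hx
    have h1 : AnalyticAt ℝ (fun x => E a x * ρ b x) x := (hEa a x hx).mul (hρa b x hx)
    have h2 : AnalyticAt ℝ (fun x => E b x * ρ a x) x := (hEa b x hx).mul (hρa a x hx)
    rw [lieDeriv_sub _ h1 h2, lieDeriv_mul _ (hEa a x hx) (hρa b x hx),
      lieDeriv_mul _ (hEa b x hx) (hρa a x hx), hEL a x hx, hEL b x hx, hρL a x hx, hρL b x hx]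
    ring
  have hCa : ∀ a b, AnalyticOnNhd ℝ (fun x => E a x * ρ b x - E b x * ρ a x) U := fun a b =>
    ((hEa a).mul (hρa b)).sub ((hEa b).mul (hρa a))
  have key : ∀ c₀ c₁ c₂ : (Fin 5 → ℝ) → ℝ, AnalyticOnNhd ℝ c₀ U → AnalyticOnNhd ℝ c₁ U →
      AnalyticOnNhd ℝ c₂ U → (∀ x ∈ U, lieDeriv (duffingField β δ ω) c₀ x = 0) →
      (∀ x ∈ U, lieDeriv (duffingField β δ ω) c₁ x = 0) →
      (∀ x ∈ U, lieDeriv (duffingField β δ ω) c₂ x = 0) →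
      (∀ x ∈ U, c₀ x * E 0 x + c₁ x * E 1 x + c₂ x * E 2 x = 0) →
      (∀ x ∈ U, c₀ x * ρ 0 x + c₁ x * ρ 1 x + c₂ x * ρ 2 x = 0) →
      ∀ x ∈ U, c₀ x = 0 ∧ c₁ x = 0 ∧ c₂ x = 0 := by
    intro c₀ c₁ c₂ a₀ a₁ a₂ l₀ l₁ l₂ hcE hcρ x hx
    have := fun a => coeff_eq_zero (c := ![c₀, c₁, c₂]) hβ hω hU hUc hΓ h0 hg hcomm hind
      (fun a => by fin_cases a <;> assumption) (fun a => by fin_cases a <;> assumption)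
      (fun x hx => by rw [Fin.sum_univ_three]; exact hcE x hx)
      (fun x hx => by rw [Fin.sum_univ_three]; exact hcρ x hx) a x hx
    exact ⟨this 0, this 1, this 2⟩
  have hneg : ∀ {φ : (Fin 5 → ℝ) → ℝ}, (∀ x ∈ U, lieDeriv (duffingField β δ ω) φ x = 0) →
      ∀ x ∈ U, lieDeriv (duffingField β δ ω) (fun x => -φ x) x = 0 := fun h x hx => by
    rw [lieDeriv_neg, h x hx, neg_zero]
  have hconst : ∀ s : ℝ, ∀ x ∈ U, lieDeriv (duffingField β δ ω) (fun _ => s) x = 0 :=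
    fun s x _ => by rw [lieDeriv_eq_fderiv, fderiv_fun_const]; rfl
  have hdet : ∀ x ∈ U, E 0 x * ρ 1 x - E 1 x * ρ 0 x = 0 := fun x hx =>
    (key _ _ _ (hCa 1 2) (hCa 2 0) (hCa 0 1) (hCL 1 2) (hCL 2 0) (hCL 0 1)
      (fun x _ => by ring) (fun x _ => by ring) x hx).2.2
  have hE0 := key (E 1) (fun x => -E 0 x) (fun _ => 0) (hEa 1) (hEa 0).neg analyticOnNhd_const
    (hEL 1) (hneg (hEL 0)) (hconst 0) (fun x _ => by ring)
    (fun x hx => by linear_combination -hdet x hx)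
  have hE0' : ∀ x ∈ U, E 0 x = 0 := fun x hx => neg_eq_zero.1 (hE0 x hx).2.1
  have hρ0 := key (ρ 1) (fun x => -ρ 0 x) (fun _ => 0) (hρa 1) (hρa 0).neg analyticOnNhd_const
    (hρL 1) (hneg (hρL 0)) (hconst 0)
    (fun x hx => by rw [hE0' x hx, (hE0 x hx).1]; ring) (fun x _ => by ring)
  have hρ0' : ∀ x ∈ U, ρ 0 x = 0 := fun x hx => neg_eq_zero.1 (hρ0 x hx).2.1
  have := key (fun _ => 1) (fun _ => 0) (fun _ => 0) analyticOnNhd_const analyticOnNhd_const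
    analyticOnNhd_const (hconst 1) (hconst 0) (hconst 0) (fun x hx => by rw [hE0' x hx]; ring)
    (fun x hx => by rw [hρ0' x hx]; ring) 0 h0
  exact one_ne_zero this.1

/-- Covectors that annihilate the phase plane and the direction of the forcing are determined
by their components `2` and `3`. -/
theorem linearIndependent_components {n : ℕ} {y : Fin 5 → ℝ} (hy : y 3 ≠ 0)
    {F : Fin n → (Fin 5 → ℝ) → ℝ}
    (h : ∀ k, partialDeriv 0 (F k) y = 0 ∧ partialDeriv 1 (F k) y = 0 ∧
      y 3 * partialDeriv 4 (F k) y = y 4 * partialDeriv 3 (F k) y)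
    (hind : LinearIndependent ℝ fun k => fderiv ℝ (F k) y) :
    LinearIndependent ℝ fun k => ![partialDeriv 2 (F k) y, partialDeriv 3 (F k) y] := by
  rw [Fintype.linearIndependent_iff] at hind ⊢
  intro c hc
  refine hind c ?_
  have e2 : ∑ k, c k * partialDeriv 2 (F k) y = 0 := by
    simpa [Finset.sum_apply] using congrFun hc 0
  have e3 : ∑ k, c k * partialDeriv 3 (F k) y = 0 := by
    simpa [Finset.sum_apply] using congrFun hc 1
  have e4 : ∑ k, c k * partialDeriv 4 (F k) y = 0 := by
    have : y 3 * ∑ k, c k * partialDeriv 4 (F k) y = y 4 * ∑ k, c k * partialDeriv 3 (F k) y := by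
      rw [Finset.mul_sum, Finset.mul_sum]
      exact Finset.sum_congr rfl fun k _ => by linear_combination (c k) * (h k).2.2
    rw [e3, mul_zero] at this
    exact (mul_eq_zero.1 this).resolve_left hy
  ext1 ξ
  have : ∀ k, fderiv ℝ (F k) y ξ = ξ 2 * partialDeriv 2 (F k) y + ξ 3 * partialDeriv 3 (F k) y
      + ξ 4 * partialDeriv 4 (F k) y := fun k => by
    rw [fderiv_eq_sum_partialDeriv, Fin.sum_univ_five, (h k).1, (h k).2.1]; ring
  simp only [sum_apply, smul_apply, smul_eq_mul, this, zero_apply]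
  calc ∑ k, c k * (ξ 2 * partialDeriv 2 (F k) y + ξ 3 * partialDeriv 3 (F k) y
        + ξ 4 * partialDeriv 4 (F k) y)
      = ξ 2 * ∑ k, c k * partialDeriv 2 (F k) y + ξ 3 * ∑ k, c k * partialDeriv 3 (F k) y
        + ξ 4 * ∑ k, c k * partialDeriv 4 (F k) y := by
        rw [Finset.mul_sum, Finset.mul_sum, Finset.mul_sum, ← Finset.sum_add_distrib,
          ← Finset.sum_add_distrib]
        exact Finset.sum_congr rfl fun k _ => by ring
    _ = 0 := by rw [e2, e3, e4]; ring

theorem not_integrable_of_preconnected (hβ : 0 < β) (hω : 0 < ω) (hU : IsOpen U)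
    (hUc : IsPreconnected U) (hΓ : ∀ t, homOrbit t ∈ U) (h0 : (0 : Fin 5 → ℝ) ∈ U) {q : ℕ}
    (hq : 1 ≤ q) (hq5 : q ≤ 5) : ¬ BogoyavlenskijIntegrable (duffingField β δ ω) U q (5 - q) := by
  rintro ⟨fs, Fs, hf, hfs, hFs, hcomm, hind, hFind, h_int⟩
  have hf0 := hf hq
  have hfa : ∀ j i, AnalyticOnNhd ℝ (fun y => fs j y i) U := fun j i x hx =>
    ((ContinuousLinearMap.proj (R := ℝ) (φ := fun _ : Fin 5 => ℝ) i).analyticAt _).comp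
      (hfs j x hx)
  have hL : ∀ j, ∀ x ∈ U, ∀ i, lieDeriv (duffingField β δ ω) (fun y => fs j y i) x
      = fderiv ℝ (fun y => duffingField β δ ω y i) x (fs j x) := by
    intro j x hx i
    have h1 := congrFun (hcomm ⟨0, hq⟩ j x hx) i
    rw [Pi.sub_apply, Pi.zero_apply, sub_eq_zero] at h1
    have happ : ∀ (k : (Fin 5 → ℝ) → Fin 5 → ℝ), DifferentiableAt ℝ k x → ∀ ξ,
        fderiv ℝ (fun y => k y i) x ξ = fderiv ℝ k x ξ i := by
      intro k hk ξ
      rw [fderiv_apply hk]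
      rfl
    have hev : fs ⟨0, hq⟩ =ᶠ[𝓝 x] duffingField β δ ω := by
      filter_upwards [hU.mem_nhds hx] with y hy using hf0 y hy
    have hd := (hfs ⟨0, hq⟩ x hx).differentiableAt
    rw [lieDeriv_eq_fderiv, happ _ (hfs j x hx).differentiableAt,
      happ _ (hd.congr_of_eventuallyEq hev.symm), ← hev.fderiv_eq, ← hf0 x hx]
    exact h1
  have hsub : ∀ n (hn : n + 1 ≤ q), ∀ᵐ x ∂volume.restrict U, ∀ (s : ℝ) (c : Fin n → ℝ),
      ∑ a, c a • fs (Fin.castLE hn a.succ) x = s • duffingField β δ ω x → c = 0 := by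
    intro n hn
    filter_upwards [hind, ae_restrict_mem hU.measurableSet] with x hx hxU s c hc
    have hli := Fintype.linearIndependent_iff.1
      (hx.comp (Fin.castLE hn) (Fin.castLE_injective hn)) (Fin.cons (-s) c) (by
        rw [Fin.sum_univ_succ]
        simp only [Fin.cons_zero, Fin.cons_succ, Function.comp_apply]
        rw [hc, show Fin.castLE hn 0 = ⟨0, hq⟩ from rfl, hf0 x hxU]
        simp)
    funext a
    simpa using hli a.succ
  have hFev : ∀ᶠ y in 𝓝 (homOrbit 0), ∀ k, partialDeriv 0 (Fs k) y = 0 ∧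
      partialDeriv 1 (Fs k) y = 0 ∧
      y 3 * partialDeriv 4 (Fs k) y = y 4 * partialDeriv 3 (Fs k) y :=
    eventually_all.2 fun k => firstIntegral_eventually hβ hω hU hΓ h0 (hFs k) fun x hx => by
      rw [← hf0 x hx]; exact h_int k _ x hx
  rcases Nat.lt_or_ge 3 q with hq4 | hq3
  · exact not_three_symmetries hβ hω hU hUc hΓ h0 (fun a => hfa (Fin.castLE hq4 a.succ))
      (fun a => hL (Fin.castLE hq4 a.succ)) (hsub 3 hq4)
  obtain ⟨y, -, hy3, hyF, hyI⟩ := exists_mem_of_eventually_of_ae hU (hΓ 0) hFev hFind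
  have hcard := (linearIndependent_components hy3 hyF hyI).fintype_card_le_finrank
  rw [Module.finrank_fin_fun, Fintype.card_fin] at hcard
  obtain rfl : q = 3 := by omega
  have hzero : ∀ y ∈ U, y 3 ≠ 0 → (∀ k, partialDeriv 0 (Fs k) y = 0 ∧
      partialDeriv 1 (Fs k) y = 0 ∧
      y 3 * partialDeriv 4 (Fs k) y = y 4 * partialDeriv 3 (Fs k) y) →
      LinearIndependent ℝ (fun k => fderiv ℝ (Fs k) y) →
      fs 1 y 2 = 0 ∧ y 3 * fs 1 y 3 + y 4 * fs 1 y 4 = 0 := by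
    intro y hyU hy3 hyF hyI
    have hli := linearIndependent_components hy3 hyF hyI
    have hspan := hli.span_eq_top_of_card_eq_finrank (by simp)
    set L : (Fin 2 → ℝ) →ₗ[ℝ] ℝ := (y 3 * fs 1 y 2) • LinearMap.proj 0
      + (y 3 * fs 1 y 3 + y 4 * fs 1 y 4) • LinearMap.proj 1 with hLdef
    have hLz : L = 0 := by
      refine LinearMap.ext_on_range hspan fun k => ?_
      have h1 := h_int k 1 y hyU
      rw [fderiv_eq_sum_partialDeriv, Fin.sum_univ_five, (hyF k).1, (hyF k).2.1] at h1
      simp [hLdef]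
      linear_combination (y 3) * h1 - fs 1 y 4 * (hyF k).2.2
    have e0 := LinearMap.congr_fun hLz ![1, 0]
    have e1 := LinearMap.congr_fun hLz ![0, 1]
    simp [hLdef, hy3] at e0 e1
    exact ⟨e0, e1⟩
  have hX := fun i => analyticOnNhd_coord i U
  have hρa : AnalyticOnNhd ℝ (fun y => y 3 * fs 1 y 3 + y 4 * fs 1 y 4) U :=
    ((hX 3).mul (hfa 1 3)).add ((hX 4).mul (hfa 1 4))
  have z2 := (hfa 1 2).eqOn_zero_of_preconnected_of_eventuallyEq_zero hUc (hΓ 0)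
    (eventually_eq_zero_of_ae hU (hΓ 0) hFev hFind (hfa 1 2).continuousOn
      fun y hyU hy3 hP hQ => (hzero y hyU hy3 hP hQ).1)
  have zρ := hρa.eqOn_zero_of_preconnected_of_eventuallyEq_zero hUc (hΓ 0)
    (eventually_eq_zero_of_ae hU (hΓ 0) hFev hFind hρa.continuousOn
      fun y hyU hy3 hP hQ => (hzero y hyU hy3 hP hQ).2)
  have := coeff_eq_zero (n := 1) (g := fun _ => fs 1) (c := fun _ _ => 1) hβ hω hU hUc hΓ h0
    (fun _ => hfa 1) (fun _ => hL 1)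
    (by simpa using hsub 1 (by omega)) (fun _ => analyticOnNhd_const)
    (fun _ x _ => by rw [lieDeriv_eq_fderiv, fderiv_fun_const]; rfl)
    (fun x hx => by simpa using z2 hx) (fun x hx => by simpa using zρ hx) 0 0 h0
  exact one_ne_zero this

end

theorem isPreconnected_endOrbit : IsPreconnected (endOrbit 1 '' Set.Ici 0) :=
  isPreconnected_Ici.image _ fun s _ => (analyticAt_endOrbit 1 s).continuousAt.continuousWithinAt

/-- If `β ≠ 0`, then the autonomous Duffing system
`ẋ₁ = x₂, ẋ₂ = x₁ − x₁³ − εδx₂ + βu₁, ε̇ = 0, u̇₁ = −ωu₂, u̇₂ = ωu₁` is not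
`(q, 5−q)`-integrable in the Bogoyavlenskij sense with real-analytic data on any open
neighborhood `U` of `Γ̂`, for any `1 ≤ q ≤ 5`. -/
theorem duffing_homoclinic_nonintegrable (β δ ω : ℝ)
    (hβpos : 0 < β) (hω : 0 < ω) (hδ : 0 ≤ δ) (hβ : β ≠ 0) :
    ∀ U : Set (Fin 5 → ℝ), IsOpen U → homoclinicSet ⊆ U →
      ∀ q : ℕ, 1 ≤ q → q ≤ 5 →
        ¬ BogoyavlenskijIntegrable (duffingField β δ ω) U q (5 - q) := by
  intro U hU hΓU q hq hq5 h_int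
  have hΓ : ∀ t, homOrbit t ∈ U := fun t => hΓU (Or.inl ⟨t, rfl⟩)
  have h0 : (0 : Fin 5 → ℝ) ∈ U := hΓU (Or.inr (by
    rw [Set.mem_singleton_iff]; funext i; fin_cases i <;> rfl))
  have horb : ∀ t, homOrbit t = endOrbit 1 (Real.exp (-t)) := fun t => by
    rw [← homOrbit_end (Or.inl rfl), one_mul]
  have hmem : ∀ t, homOrbit t ∈ endOrbit 1 '' Set.Ici 0 := fun t =>
    ⟨Real.exp (-t), (Real.exp_pos _).le, (horb t).symm⟩
  have hsub : endOrbit 1 '' Set.Ici 0 ⊆ connectedComponentIn U (homOrbit 0) := by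
    refine isPreconnected_endOrbit.subset_connectedComponentIn (hmem 0) ?_
    rintro _ ⟨s, hs, rfl⟩
    rcases eq_or_lt_of_le (Set.mem_Ici.1 hs) with rfl | hs
    · rwa [endOrbit_zero]
    · have := horb (-Real.log s)
      rw [neg_neg, Real.exp_log hs] at this
      rw [← this]
      exact hΓ _
  refine not_integrable_of_preconnected hβpos hω hU.connectedComponentIn
    isPreconnected_connectedComponentIn (fun t => hsub (hmem t)) (hsub ?_) hq hq5
    (h_int.mono (connectedComponentIn_subset U (homOrbit 0)))
  exact ⟨0, Set.self_mem_Ici, endOrbit_zero 1⟩
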